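/- arXiv:2503.20106 — 2 statements merged into one kernel-verified Lean document; each statement's English description precedes it below -/
import Mathlib

section
/- Let G be a simple 3-connected graph, and let e and f be two distinct edges of G. Then G has a cc-minor H containing e and f such that one of the following holds: (i) H is isomorphic to a bond graph B_n containing e and f, for some n ≥ 3; or (ii) H is isomorphic to a fan-type graph of which e and f are distinct outer spokes that are not parallel; or (iii) a simplification of H has e and f as non-adjacent edges and is isomorphic to K_4, and moreover, every edge g of H that is not parallel to e or f is not parallel to any edge of H. -/
open scoped Classical

noncomputable section

/-- A finite multigraph with vertices and edge names drawn from `ℕ`.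
Each edge name `e ∈ E` has a pair of (possibly equal) endpoints `ends e`. -/
structure MGraph where
  V : Finset ℕ
  E : Finset ℕ
  ends : ℕ → Sym2 ℕ
  ends_mem : ∀ e ∈ E, ∀ v ∈ ends e, v ∈ V

namespace MGraph

/-- Adjacency via some edge. -/
def Adj (G : MGraph) (u v : ℕ) : Prop := ∃ e ∈ G.E, G.ends e = s(u, v)

/-- Reachability. -/
def Reach (G : MGraph) : ℕ → ℕ → Prop := Relation.ReflTransGen G.Adj

/-- A graph is connected if it has a vertex and all vertices are mutually reachable. -/
def Connected (G : MGraph) : Prop :=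
  G.V.Nonempty ∧ ∀ u ∈ G.V, ∀ v ∈ G.V, G.Reach u v

/-- Delete a set of edges. -/
def deleteEdges (G : MGraph) (Z : Finset ℕ) : MGraph where
  V := G.V
  E := G.E \ Z
  ends := G.ends
  ends_mem := fun e he => G.ends_mem e (Finset.mem_sdiff.mp he).1

/-- A graph with at least two vertices is `k`-edge-connected if deleting any
set of fewer than `k` edges leaves it connected. -/
def EdgeConnected (G : MGraph) (k : ℕ) : Prop :=
  2 ≤ G.V.card ∧ ∀ Z ⊆ G.E, Z.card < k → (G.deleteEdges Z).Connected

/-- A graph is loopless if no edge has equal endpoints. -/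
def Loopless (G : MGraph) : Prop := ∀ e ∈ G.E, ¬ (G.ends e).IsDiag

/-- The set of vertices met by an edge set. -/
def vertsOf (G : MGraph) (C : Finset ℕ) : Finset ℕ :=
  G.V.filter (fun v => ∃ e ∈ C, v ∈ G.ends e)

/-- Degree of `v` in the edge set `C` (loops counted twice). -/
def degIn (G : MGraph) (C : Finset ℕ) (v : ℕ) : ℕ :=
  ∑ e ∈ C, (if G.ends e = s(v, v) then 2 else if v ∈ G.ends e then 1 else 0)

/-- `C` is the edge set of a cycle of `G`: a nonempty connected edge set in which
every vertex met has degree exactly two (a loop and a pair of parallel edges are cycles). -/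
def IsCycleSet (G : MGraph) (C : Finset ℕ) : Prop :=
  C.Nonempty ∧ C ⊆ G.E ∧
  (∀ v ∈ G.vertsOf C, G.degIn C v = 2) ∧
  ∀ u ∈ G.vertsOf C, ∀ v ∈ G.vertsOf C,
    Relation.ReflTransGen (fun a b => ∃ e ∈ C, G.ends e = s(a, b)) u v

/-- The vertex map identifying all vertices of `U` (within `G.V`) to a single one. -/
def cmapOn (G : MGraph) (U : Finset ℕ) : ℕ → ℕ :=
  fun v => if v ∈ U ∩ G.V then sInf {w : ℕ | w ∈ U ∩ G.V} else v

/-- Contract the vertex set `U` to a single vertex, deleting the edges of `S` and all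
newly created loops (edges with both ends in `U` that were not already loops), while
keeping pre-existing loops not in `S`. -/
def contractOn (G : MGraph) (U S : Finset ℕ) : MGraph where
  V := G.V.image (G.cmapOn U)
  E := G.E.filter (fun e => ¬ (∀ v ∈ G.ends e, v ∈ U) ∨ ((G.ends e).IsDiag ∧ e ∉ S))
  ends := fun e => (G.ends e).map (G.cmapOn U)
  ends_mem := by
    intro e he v hv
    have he' : e ∈ G.E := (Finset.mem_filter.mp he).1
    rw [Sym2.mem_map] at hv
    obtain ⟨w, hw, rfl⟩ := hv
    have hwV : w ∈ G.V := G.ends_mem e he' w hw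
    by_cases h : w ∈ U ∩ G.V
    · have hmem : sInf {x : ℕ | x ∈ U ∩ G.V} ∈ U ∩ G.V := Nat.sInf_mem ⟨w, h⟩
      refine Finset.mem_image.mpr ⟨sInf {x : ℕ | x ∈ U ∩ G.V},
        (Finset.mem_inter.mp hmem).2, ?_⟩
      simp [cmapOn, h, hmem]
    · exact Finset.mem_image.mpr ⟨w, hwV, by simp [cmapOn, h]⟩

/-- Contract a cycle (given by its edge set), deleting all created loops. -/
def contractCycle (G : MGraph) (C : Finset ℕ) : MGraph :=
  G.contractOn (G.vertsOf C) C

/-- `H` is a cycle-contraction minor (cc-minor) of `G`: `H` is obtained from `G` by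
a sequence of cycle contractions (each accompanied by contraction of created loops). -/
def CCMinor (G H : MGraph) : Prop :=
  Relation.ReflTransGen (fun A B => ∃ C, A.IsCycleSet C ∧ B = A.contractCycle C) G H

/-- Walks: a vertex list together with a matching edge list. -/
inductive IsWalk (G : MGraph) : List ℕ → List ℕ → Prop
  | nil {v : ℕ} (hv : v ∈ G.V) : IsWalk G [v] []
  | cons {u v : ℕ} {e : ℕ} {vs es : List ℕ} (he : e ∈ G.E)
      (hends : G.ends e = s(u, v)) (hw : IsWalk G (v :: vs) es) :
      IsWalk G (u :: v :: vs) (e :: es)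

/-- A path from `u` to `v`, given by its vertex list and edge list. -/
def IsPathBetween (G : MGraph) (u v : ℕ) (vs es : List ℕ) : Prop :=
  G.IsWalk vs es ∧ vs.Nodup ∧ vs.head? = some u ∧ vs.getLast? = some v

/-- `G` is `k`-connected: it has at least `k` vertices and any two distinct vertices are
joined by at least `k` pairwise internally disjoint paths. -/
def KConnected (G : MGraph) (k : ℕ) : Prop :=
  k ≤ G.V.card ∧ ∀ u ∈ G.V, ∀ v ∈ G.V, u ≠ v →
    ∃ P : Fin k → List ℕ × List ℕ,
      (∀ i, G.IsPathBetween u v (P i).1 (P i).2) ∧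
      ∀ i j, i ≠ j →
        (∀ x, x ∈ (P i).1 → x ∈ (P j).1 → x = u ∨ x = v) ∧
        (∀ e, e ∈ (P i).2 → e ∉ (P j).2)

/-- A simple graph: no loops and no parallel edges. -/
def Simple (G : MGraph) : Prop :=
  G.Loopless ∧ ∀ e ∈ G.E, ∀ f ∈ G.E, G.ends e = G.ends f → e = f

/-- Graph isomorphism. -/
def Iso (G H : MGraph) : Prop :=
  ∃ φ ψ : ℕ → ℕ, Set.BijOn φ ↑G.V ↑H.V ∧ Set.BijOn ψ ↑G.E ↑H.E ∧
    ∀ e ∈ G.E, H.ends (ψ e) = (G.ends e).map φ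

/-- The bond graph `B n`: two vertices joined by `n` parallel edges. -/
def IsBondGraph (H : MGraph) (n : ℕ) : Prop :=
  ∃ u v : ℕ, u ≠ v ∧ H.V = {u, v} ∧ H.E.card = n ∧ ∀ e ∈ H.E, H.ends e = s(u, v)

end MGraph

namespace MGraph

/-- `F` is a subgraph of `G`. -/
def IsSubgraph (F G : MGraph) : Prop :=
  F.V ⊆ G.V ∧ F.E ⊆ G.E ∧ ∀ e ∈ F.E, F.ends e = G.ends e

end MGraph

/-- `H` is a fan-type graph with hub `u`, path `vs`, path edges `pE`, and, for each path
vertex `w`, a nonempty set `S w` of parallel spokes joining `u` to `w`. -/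
def IsFanType (H : MGraph) (u : ℕ) (vs : List ℕ) (pE : List ℕ) (S : ℕ → Finset ℕ) : Prop :=
  vs ≠ [] ∧ vs.Nodup ∧ u ∉ vs ∧
  H.V = insert u vs.toFinset ∧
  pE.length + 1 = vs.length ∧ pE.Nodup ∧
  (∀ i : ℕ, i + 1 < vs.length → pE[i]! ∈ H.E ∧ H.ends pE[i]! = s(vs[i]!, vs[i + 1]!)) ∧
  (∀ w ∈ vs, (S w).Nonempty ∧ ∀ g ∈ S w, g ∈ H.E ∧ H.ends g = s(u, w)) ∧
  H.E = pE.toFinset ∪ vs.toFinset.biUnion S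

/-- `H'` is a simplification of `H`: delete all loops and all but one edge from each
maximal set of parallel edges. -/
def IsSimplification (H H' : MGraph) : Prop :=
  H'.V = H.V ∧ H'.E ⊆ H.E ∧ (∀ g ∈ H'.E, H'.ends g = H.ends g) ∧
  (∀ g ∈ H'.E, ¬ (H.ends g).IsDiag) ∧
  (∀ g ∈ H'.E, ∀ g' ∈ H'.E, H.ends g = H.ends g' → g = g') ∧
  (∀ g ∈ H.E, ¬ (H.ends g).IsDiag → ∃ g' ∈ H'.E, H.ends g' = H.ends g)

/-- `L` is (isomorphic to) the complete graph `K₄`. -/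
def IsK4 (L : MGraph) : Prop :=
  L.V.card = 4 ∧ L.E.card = 6 ∧ (∀ g ∈ L.E, ¬ (L.ends g).IsDiag) ∧
  ∀ u ∈ L.V, ∀ v ∈ L.V, u ≠ v → ∃ g ∈ L.E, L.ends g = s(u, v)

/-- `IsLink r x l y`: the list `l` consists of the consecutive interior vertices of an
`r`-walk from `x` to `y`. -/
def IsLink (r : ℕ → ℕ → Prop) : ℕ → List ℕ → ℕ → Prop
  | x, [], y => r x y
  | x, z :: l, y => r x z ∧ IsLink r z l y

/-- Any two vertices of `A` are joined by an `r`-walk inside `A`. -/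
def ConnIn (r : ℕ → ℕ → Prop) (A : Set ℕ) : Prop :=
  ∀ x ∈ A, ∀ y ∈ A, Relation.ReflTransGen (fun p q => r p q ∧ q ∈ A) x y

theorem isLink_append {r : ℕ → ℕ → Prop} {x y z : ℕ} {l₁ l₂ : List ℕ} :
    IsLink r x (l₁ ++ z :: l₂) y ↔ IsLink r x l₁ z ∧ IsLink r z l₂ y := by
  induction l₁ generalizing x with
  | nil => simp [IsLink]
  | cons w l ih => simp [IsLink, ih, and_assoc]

theorem IsLink.reverse {r : ℕ → ℕ → Prop} (hr : ∀ x y, r x y → r y x) {x y : ℕ} {l : List ℕ}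
    (h : IsLink r x l y) : IsLink r y l.reverse x := by
  induction l generalizing x with
  | nil => exact hr _ _ h
  | cons z l ih =>
    rw [List.reverse_cons, isLink_append]
    exact ⟨ih h.2, hr _ _ h.1⟩

theorem IsLink.shorten {r : ℕ → ℕ → Prop} {x y : ℕ} {l : List ℕ} (h : IsLink r x l y) :
    ∃ l', IsLink r x l' y ∧ (∀ v ∈ l', v ∈ l) ∧ l'.Nodup ∧ x ∉ l' ∧ y ∉ l' := by
  induction l generalizing x with
  | nil => exact ⟨[], h, by simp⟩
  | cons z l ih =>
    obtain ⟨l', h1, h2, h3, h4, h5⟩ := ih h.2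
    by_cases hyz : y = z
    · exact ⟨[], by simpa [IsLink, hyz] using h.1, by simp⟩
    by_cases hxz : x = z
    · subst hxz
      exact ⟨l', h1, fun v hv => List.mem_cons_of_mem _ (h2 v hv), h3, h4, h5⟩
    by_cases hx : x ∈ l'
    · obtain ⟨p, q, rfl⟩ := List.append_of_mem hx
      rw [isLink_append] at h1
      refine ⟨q, h1.2, fun v hv => List.mem_cons_of_mem _ (h2 v (by simp [hv])), ?_, ?_, ?_⟩
      all_goals grind
    · refine ⟨z :: l', ⟨h.1, h1⟩, ?_, ?_, ?_, ?_⟩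
      all_goals grind

theorem ConnIn.exists_isLink {r : ℕ → ℕ → Prop} {A X : Set ℕ} (hA : ConnIn r A) {x y : ℕ}
    (hx : x ∈ A) (hxX : x ∉ X) (hy : y ∈ A) (hyX : y ∈ X) :
    ∃ h l, h ∈ A ∧ h ∈ X ∧ IsLink r x l h ∧ ∀ v ∈ l, v ∈ A ∧ v ∉ X ∧ v ≠ x := by
  have key : ∀ x, Relation.ReflTransGen (fun p q => r p q ∧ q ∈ A) x y → x ∉ X →
      ∃ h l, h ∈ A ∧ h ∈ X ∧ IsLink r x l h ∧ ∀ v ∈ l, v ∈ A ∧ v ∉ X := by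
    intro x hw
    induction hw using Relation.ReflTransGen.head_induction_on with
    | refl => exact fun h => absurd hyX h
    | @head p q hpq _ ih =>
      intro hp
      by_cases hq : q ∈ X
      · exact ⟨q, [], hpq.2, hq, hpq.1, by simp⟩
      · obtain ⟨h, l, h1, h2, h3, h4⟩ := ih hq
        exact ⟨h, q :: l, h1, h2, ⟨hpq.1, h3⟩, by grind⟩
  obtain ⟨h, l, h1, h2, h3, h4⟩ := key x (hA x hx y hy) hxX
  obtain ⟨l', k1, k2, -, k3, -⟩ := h3.shorten
  exact ⟨h, l', h1, h2, k1, fun v hv => ⟨(h4 v (k2 v hv)).1, (h4 v (k2 v hv)).2, by grind⟩⟩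

/-- Fan lemma: if removing `a` leaves a graph without cut vertices, then a link from `b` to
`x₀ ∈ X` can be replaced by a pair of disjoint links from `b` to `X`, one of them still
ending at `x₀`. -/
theorem exists_two_links {r : ℕ → ℕ → Prop} {V X : Set ℕ} {a x₀ x₁ : ℕ}
    (hV : ∀ v, ConnIn r (V \ {a, v})) (hXV : X ⊆ V) (ha : a ∉ X)
    (hx₀ : x₀ ∈ X) (hx₁ : x₁ ∈ X) (hne : x₁ ≠ x₀) {l : List ℕ} {b : ℕ}
    (hb : b ∈ V) (hba : b ≠ a) (hbX : b ∉ X) (hl : IsLink r b l x₀)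
    (hlV : ∀ v ∈ l, v ∈ V ∧ v ≠ a ∧ v ∉ X) :
    ∃ l₁ l₂ t, t ∈ X ∧ t ≠ x₀ ∧ IsLink r b l₁ x₀ ∧ IsLink r b l₂ t ∧
      (∀ v ∈ l₁, v ∈ V ∧ v ≠ a ∧ v ∉ X ∧ v ≠ b ∧ v ∉ l₂) ∧
      (∀ v ∈ l₂, v ∈ V ∧ v ≠ a ∧ v ∉ X ∧ v ≠ b) := by
  induction l generalizing b with
  | nil =>
    obtain ⟨h, l, h1, h2, h3, h4⟩ := (hV x₀).exists_isLink (X := X) (x := b) (y := x₁)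
      (by grind) hbX (by grind) hx₁
    exact ⟨[], l, h, h2, by grind, hl, h3, by simp, by grind⟩
  | cons w l ih =>
    have hw := hlV w (by simp)
    obtain ⟨l₁, l₂, t, ht, htx, h1, h2, h3, h4⟩ :=
      ih hw.1 hw.2.1 hw.2.2 hl.2 (fun v hv => hlV v (by simp [hv]))
    have hbw := hl.1
    by_cases hbweq : b = w
    · subst hbweq
      exact ⟨l₁, l₂, t, ht, htx, h1, h2, h3, h4⟩
    by_cases hb1 : b ∈ l₁
    · obtain ⟨p, q, rfl⟩ := List.append_of_mem hb1
      obtain ⟨q', k1, k2, -, k3, -⟩ := (isLink_append.1 h1).2.shorten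
      refine ⟨q', w :: l₂, t, ht, htx, k1, ⟨hbw, h2⟩, ?_, ?_⟩ <;> grind
    by_cases hb2 : b ∈ l₂
    · obtain ⟨p, q, rfl⟩ := List.append_of_mem hb2
      obtain ⟨q', k1, k2, -, k3, -⟩ := (isLink_append.1 h2).2.shorten
      refine ⟨w :: l₁, q', t, ht, htx, ⟨hbw, h1⟩, k1, ?_, ?_⟩ <;> grind
    obtain ⟨h, m, m1, m2, m3, m4⟩ := (hV w).exists_isLink
      (X := X ∪ {v | v ∈ l₁ ∨ v ∈ l₂}) (x := b) (y := x₀) (by grind) (by grind) (by grind)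
      (by grind)
    simp only [Set.mem_union, Set.mem_ofPred_eq] at m2 m4
    rcases m2 with m2 | m2 | m2
    · by_cases hx : h = x₀
      · subst hx
        exact ⟨m, w :: l₂, t, ht, htx, m3, ⟨hbw, h2⟩, by grind, by grind⟩
      · exact ⟨w :: l₁, m, h, m2, hx, ⟨hbw, h1⟩, m3, by grind, by grind⟩
    · obtain ⟨p, q, rfl⟩ := List.append_of_mem m2
      exact ⟨m ++ h :: q, w :: l₂, t, ht, htx, isLink_append.2 ⟨m3, (isLink_append.1 h1).2⟩,
        ⟨hbw, h2⟩, by grind, by grind⟩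
    · obtain ⟨p, q, rfl⟩ := List.append_of_mem m2
      exact ⟨w :: l₁, m ++ h :: q, t, ht, htx, ⟨hbw, h1⟩,
        isLink_append.2 ⟨m3, (isLink_append.1 h2).2⟩, by grind, by grind⟩

/-- Two links from `x` to `y`, not both trivial, and a third link from `x'` to `y'`,
pairwise disjoint and avoiding the four corners. -/
def HasDoubleLink (r : ℕ → ℕ → Prop) (V : Set ℕ) (x x' y y' : ℕ) : Prop :=
  ∃ m₁ m₂ m₃, IsLink r x m₁ y ∧ IsLink r x m₂ y ∧ IsLink r x' m₃ y' ∧ (m₁ ≠ [] ∨ m₂ ≠ []) ∧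
    (∀ v ∈ m₁, v ∈ V ∧ v ≠ x ∧ v ≠ x' ∧ v ≠ y ∧ v ≠ y' ∧ v ∉ m₂ ∧ v ∉ m₃) ∧
    (∀ v ∈ m₂, v ∈ V ∧ v ≠ x ∧ v ≠ x' ∧ v ≠ y ∧ v ≠ y' ∧ v ∉ m₃) ∧
    (∀ v ∈ m₃, v ∈ V ∧ v ≠ x ∧ v ≠ x' ∧ v ≠ y ∧ v ≠ y')

/-- Four pairwise disjoint links forming a cycle through `a`, `c`, `b`, `d` in this order. -/
def HasLinkCycle (r : ℕ → ℕ → Prop) (V : Set ℕ) (a c b d : ℕ) : Prop :=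
  ∃ l₁ l₂ l₃ l₄, IsLink r a l₁ c ∧ IsLink r c l₂ b ∧ IsLink r b l₃ d ∧ IsLink r d l₄ a ∧
    (∀ v ∈ l₁, v ∈ V ∧ v ≠ a ∧ v ≠ b ∧ v ≠ c ∧ v ≠ d ∧ v ∉ l₂ ∧ v ∉ l₃ ∧ v ∉ l₄) ∧
    (∀ v ∈ l₂, v ∈ V ∧ v ≠ a ∧ v ≠ b ∧ v ≠ c ∧ v ≠ d ∧ v ∉ l₃ ∧ v ∉ l₄) ∧
    (∀ v ∈ l₃, v ∈ V ∧ v ≠ a ∧ v ≠ b ∧ v ≠ c ∧ v ≠ d ∧ v ∉ l₄) ∧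
    (∀ v ∈ l₄, v ∈ V ∧ v ≠ a ∧ v ≠ b ∧ v ≠ c ∧ v ≠ d)

/-- The four possible orientations of a double link between `{a, b}` and `{c, d}`. -/
def HasSomeDoubleLink (r : ℕ → ℕ → Prop) (V : Set ℕ) (a b c d : ℕ) : Prop :=
  HasDoubleLink r V a b c d ∨ HasDoubleLink r V b a c d ∨
    HasDoubleLink r V a b d c ∨ HasDoubleLink r V b a d c

set_option maxHeartbeats 1600000 in
theorem hasLinkCycle_or_of_links {r : ℕ → ℕ → Prop} (hr : ∀ x y, r x y → r y x) {V : Set ℕ}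
    (hV : ∀ p q, ConnIn r (V \ {p, q})) {a b c d : ℕ} (haV : a ∈ V) (hbV : b ∈ V) (hcV : c ∈ V)
    (hdV : d ∈ V) (hab : a ≠ b) (hac : a ≠ c) (had : a ≠ d) (hbc : b ≠ c) (hbd : b ≠ d)
    (hcd : c ≠ d) {α β γ : List ℕ} (hα : IsLink r a α d) (hβ : IsLink r b β c)
    (hγ : IsLink r a γ c)
    (hα' : ∀ v ∈ α, v ∈ V ∧ v ≠ a ∧ v ≠ b ∧ v ≠ c ∧ v ≠ d ∧ v ∉ β ∧ v ∉ γ)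
    (hβ' : ∀ v ∈ β, v ∈ V ∧ v ≠ a ∧ v ≠ b ∧ v ≠ c ∧ v ≠ d ∧ v ∉ γ)
    (hγ' : ∀ v ∈ γ, v ∈ V ∧ v ≠ a ∧ v ≠ b ∧ v ≠ c ∧ v ≠ d) :
    HasLinkCycle r V a c b d ∨ HasSomeDoubleLink r V a b c d := by
  obtain ⟨α', hα1, hα2, hα3, -, -⟩ := hα.shorten
  replace hα' : ∀ v ∈ α', v ∈ V ∧ v ≠ a ∧ v ≠ b ∧ v ≠ c ∧ v ≠ d ∧ v ∉ β ∧ v ∉ γ :=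
    fun v hv => hα' v (hα2 v hv)
  clear hα2 hα
  obtain ⟨β₁, β₂, t, ht, htc, h1, h2, h3, h4⟩ := exists_two_links (hV a)
    (X := {v | v ∈ α' ∨ v ∈ γ ∨ v = c ∨ v = d}) (x₀ := c) (x₁ := d) (l := β) (b := b)
    (by rintro v (h | h | rfl | rfl) <;> grind)
    (by simp only [Set.mem_ofPred_eq]; grind) (by simp) (by simp) hcd.symm hbV hab.symm
    (by simp only [Set.mem_ofPred_eq]; grind) hβ (by simp only [Set.mem_ofPred_eq]; grind)
  simp only [Set.mem_ofPred_eq] at ht h3 h4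
  have hβ1r := h1.reverse hr
  rcases ht with ht | ht | ht | rfl
  · obtain ⟨α₁, α₂, rfl⟩ := List.append_of_mem ht
    obtain ⟨k1, k2⟩ := isLink_append.1 hα1
    have k2r := k2.reverse hr
    obtain ⟨δ₁, δ₂, t', ht', htt, g1, g2, g3, g4⟩ := exists_two_links (hV c)
      (X := {v | v = t ∨ v ∈ α₁ ∨ v ∈ β₁ ∨ v ∈ β₂ ∨ v ∈ γ ∨ v = a ∨ v = b}) (x₀ := t) (x₁ := a)
      (l := α₂.reverse) (b := d)
      (by rintro v (rfl | h | h | h | h | rfl | rfl) <;> grind)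
      (by simp only [Set.mem_ofPred_eq]; grind) (by simp) (by simp) (by grind) hdV hcd.symm
      (by simp only [Set.mem_ofPred_eq]; grind) k2r (by simp only [Set.mem_ofPred_eq]; grind)
    simp only [Set.mem_ofPred_eq] at ht' g3 g4
    have g1r := g1.reverse hr
    have g2r := g2.reverse hr
    have k1r := k1.reverse hr
    rcases ht' with ht' | ht' | ht' | ht' | ht' | ht' | ht'
    · exact absurd ht' htt
    · obtain ⟨p, q, rfl⟩ := List.append_of_mem ht'
      obtain ⟨j1, j2⟩ := isLink_append.1 k1
      refine Or.inl ⟨γ, β₁.reverse, β₂ ++ t :: δ₁.reverse, δ₂ ++ t' :: p.reverse, hγ, hβ1r,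
        isLink_append.2 ⟨h2, g1r⟩, isLink_append.2 ⟨g2, j1.reverse hr⟩, ?_, ?_, ?_, ?_⟩ <;> grind
    · obtain ⟨p, q, rfl⟩ := List.append_of_mem ht'
      obtain ⟨j1, j2⟩ := isLink_append.1 h1
      refine Or.inr (Or.inr (Or.inr (Or.inr ⟨p ++ t' :: δ₂.reverse, β₂ ++ t :: δ₁.reverse, γ,
        isLink_append.2 ⟨j1, g2r⟩, isLink_append.2 ⟨h2, g1r⟩, hγ, by simp, ?_, ?_, ?_⟩))) <;> grind
    · obtain ⟨p, q, rfl⟩ := List.append_of_mem ht'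
      obtain ⟨j1, j2⟩ := isLink_append.1 h2
      refine Or.inl ⟨γ, β₁.reverse, p ++ t' :: δ₂.reverse, δ₁ ++ t :: α₁.reverse, hγ, hβ1r,
        isLink_append.2 ⟨j1, g2r⟩, isLink_append.2 ⟨g1, k1r⟩, ?_, ?_, ?_, ?_⟩ <;> grind
    · obtain ⟨p, q, rfl⟩ := List.append_of_mem ht'
      obtain ⟨j1, j2⟩ := isLink_append.1 hγ
      refine Or.inr (Or.inr (Or.inr (Or.inl ⟨p ++ t' :: δ₂.reverse, α₁ ++ t :: δ₁.reverse, β₁,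
        isLink_append.2 ⟨j1, g2r⟩, isLink_append.2 ⟨k1, g1r⟩, h1, by simp, ?_, ?_, ?_⟩))) <;> grind
    · subst ht'
      refine Or.inl ⟨γ, β₁.reverse, β₂ ++ t :: δ₁.reverse, δ₂, hγ, hβ1r,
        isLink_append.2 ⟨h2, g1r⟩, g2, ?_, ?_, ?_, ?_⟩ <;> grind
    · subst ht'
      refine Or.inl ⟨γ, β₁.reverse, δ₂.reverse, δ₁ ++ t :: α₁.reverse, hγ, hβ1r,
        g2r, isLink_append.2 ⟨g1, k1r⟩, ?_, ?_, ?_, ?_⟩ <;> grind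
  · obtain ⟨p, q, rfl⟩ := List.append_of_mem ht
    obtain ⟨j1, j2⟩ := isLink_append.1 hγ
    refine Or.inr (Or.inr (Or.inl ⟨β₁, β₂ ++ t :: q, α', h1, isLink_append.2 ⟨h2, j2⟩, hα1,
      by simp, ?_, ?_, ?_⟩)) <;> grind
  · exact absurd ht htc
  · exact Or.inl ⟨γ, β₁.reverse, β₂, α'.reverse, hγ, hβ1r, h2, hα1.reverse hr, by grind, by grind,
      by grind, by grind⟩

theorem hasLinkCycle_or_of_double {r : ℕ → ℕ → Prop} (hr : ∀ x y, r x y → r y x) {V : Set ℕ}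
    (hV : ∀ p q, ConnIn r (V \ {p, q})) {a b c d : ℕ} (haV : a ∈ V) (hbV : b ∈ V) (hcV : c ∈ V)
    (hdV : d ∈ V) (hab : a ≠ b) (hac : a ≠ c) (had : a ≠ d) (hbc : b ≠ c) (hbd : b ≠ d)
    (hcd : c ≠ d) {β I J : List ℕ} (hβ : IsLink r b β c) (hI : IsLink r a I c)
    (hJ : IsLink r a J c) (hIJ : I ≠ [] ∨ J ≠ [])
    (hβ' : ∀ v ∈ β, v ∈ V ∧ v ≠ a ∧ v ≠ b ∧ v ≠ c ∧ v ∉ I ∧ v ∉ J)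
    (hI' : ∀ v ∈ I, v ∈ V ∧ v ≠ a ∧ v ≠ b ∧ v ≠ c ∧ v ∉ J)
    (hJ' : ∀ v ∈ J, v ∈ V ∧ v ≠ a ∧ v ≠ b ∧ v ≠ c)
    (hIn : I.Nodup) (hJn : J.Nodup) (hβn : β.Nodup) :
    HasLinkCycle r V a c b d ∨ HasSomeDoubleLink r V a b c d := by
  by_cases hdβ : d ∈ β
  · obtain ⟨p, q, rfl⟩ := List.append_of_mem hdβ
    obtain ⟨j1, j2⟩ := isLink_append.1 hβ
    exact Or.inr (Or.inl ⟨I, J, p, hI, hJ, j1, hIJ, by grind, by grind, by grind⟩)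
  by_cases hdI : d ∈ I
  · obtain ⟨p, q, rfl⟩ := List.append_of_mem hdI
    obtain ⟨j1, j2⟩ := isLink_append.1 hI
    exact hasLinkCycle_or_of_links hr hV haV hbV hcV hdV hab hac had hbc hbd hcd
      j1 hβ hJ (by grind) (by grind) (by grind)
  by_cases hdJ : d ∈ J
  · obtain ⟨p, q, rfl⟩ := List.append_of_mem hdJ
    obtain ⟨j1, j2⟩ := isLink_append.1 hJ
    exact hasLinkCycle_or_of_links hr hV haV hbV hcV hdV hab hac had hbc hbd hcd
      j1 hβ hI (by grind) (by grind) (by grind)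
  obtain ⟨h, l, h1, h2, h3, h4⟩ := (hV c c).exists_isLink
    (X := {v | v ∈ I ∨ v ∈ J ∨ v ∈ β ∨ v = a ∨ v = b}) (x := d) (y := a) (by grind)
    (by simp only [Set.mem_ofPred_eq]; grind) (by grind) (by simp)
  simp only [Set.mem_ofPred_eq] at h2 h4
  have h3r := h3.reverse hr
  rcases h2 with h2 | h2 | h2 | rfl | rfl
  · obtain ⟨p, q, rfl⟩ := List.append_of_mem h2
    obtain ⟨j1, j2⟩ := isLink_append.1 hI
    exact hasLinkCycle_or_of_links hr hV haV hbV hcV hdV hab hac had hbc hbd hcd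
      (isLink_append.2 ⟨j1, h3r⟩) hβ hJ (by grind) (by grind) (by grind)
  · obtain ⟨p, q, rfl⟩ := List.append_of_mem h2
    obtain ⟨j1, j2⟩ := isLink_append.1 hJ
    exact hasLinkCycle_or_of_links hr hV haV hbV hcV hdV hab hac had hbc hbd hcd
      (isLink_append.2 ⟨j1, h3r⟩) hβ hI (by grind) (by grind) (by grind)
  · obtain ⟨p, q, rfl⟩ := List.append_of_mem h2
    obtain ⟨j1, j2⟩ := isLink_append.1 hβ
    exact Or.inr (Or.inl ⟨I, J, p ++ h :: l.reverse, hI, hJ, isLink_append.2 ⟨j1, h3r⟩, hIJ,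
      by grind, by grind, by grind⟩)
  · exact hasLinkCycle_or_of_links hr hV haV hbV hcV hdV hab hac had hbc hbd hcd
      h3r hβ hI (by grind) (by grind) (by grind)
  · exact Or.inr (Or.inl ⟨I, J, l.reverse, hI, hJ, h3r, hIJ, by grind, by grind, by grind⟩)

theorem hasLinkCycle_or_hasSomeDoubleLink {r : ℕ → ℕ → Prop} (hr : ∀ x y, r x y → r y x)
    {V : Set ℕ} (hV : ∀ p q, ConnIn r (V \ {p, q})) {a b c d : ℕ} (haV : a ∈ V) (hbV : b ∈ V)
    (hcV : c ∈ V) (hdV : d ∈ V) (hab : a ≠ b) (hac : a ≠ c) (had : a ≠ d) (hbc : b ≠ c)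
    (hbd : b ≠ d) (hcd : c ≠ d) (I : Fin 3 → List ℕ) (hI : ∀ i, IsLink r a (I i) c)
    (hIn : ∀ i, (I i).Nodup) (hI' : ∀ i, ∀ v ∈ I i, v ∈ V ∧ v ≠ a ∧ v ≠ c)
    (hdisj : ∀ i j, i ≠ j → ∀ v ∈ I i, v ∉ I j) (hne : ∀ i j, i ≠ j → I i ≠ [] ∨ I j ≠ []) :
    HasLinkCycle r V a c b d ∨ HasSomeDoubleLink r V a b c d := by
  have hothers : ∀ k : Fin 3, ∃ i j, i ≠ j ∧ i ≠ k ∧ j ≠ k := by decide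
  suffices h : ∃ k β, IsLink r b β c ∧ β.Nodup ∧
      (∀ v ∈ β, v ∈ V ∧ v ≠ a ∧ v ≠ b ∧ v ≠ c) ∧ ∀ i ≠ k, b ∉ I i ∧ ∀ v ∈ β, v ∉ I i by
    obtain ⟨k, β, h1, h2, h3, h4⟩ := h
    obtain ⟨i, j, hij, hik, hjk⟩ := hothers k
    refine hasLinkCycle_or_of_double hr hV haV hbV hcV hdV hab hac had hbc hbd hcd h1 (hI i)
      (hI j) (hne i j hij) ?_ ?_ ?_ (hIn i) (hIn j) h2
    · exact fun v hv => ⟨(h3 v hv).1, (h3 v hv).2.1, (h3 v hv).2.2.1, (h3 v hv).2.2.2,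
        (h4 i hik).2 v hv, (h4 j hjk).2 v hv⟩
    · have := (h4 i hik).1
      have := hdisj i j hij
      have := hI' i
      grind
    · have := (h4 j hjk).1
      have := hI' j
      grind
  by_cases hb : ∃ k, b ∈ I k
  · obtain ⟨k, hk⟩ := hb
    obtain ⟨p, q, hpq⟩ := List.append_of_mem hk
    have h1 := hI k
    have h2 := hIn k
    have h3 := hI' k
    have h4 := hdisj k
    rw [hpq] at h1 h2 h3 h4
    refine ⟨k, q, (isLink_append.1 h1).2, by grind, by grind, fun i hi => ?_⟩
    have := h4 i hi.symm
    grind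
  push Not at hb
  obtain ⟨h, l, h1, h2, h3, h4⟩ := (hV a a).exists_isLink
    (X := {v | (∃ i, v ∈ I i) ∨ v = c}) (x := b) (y := c) (by grind)
    (by simp only [Set.mem_ofPred_eq]; grind) (by grind) (by simp)
  simp only [Set.mem_ofPred_eq] at h2 h4
  rcases h2 with ⟨k, hk⟩ | rfl
  · obtain ⟨p, q, hpq⟩ := List.append_of_mem hk
    have k1 := hI k
    have k2 := hIn k
    have k3 := hI' k
    have k4 := hdisj k
    have k5 := hb k
    rw [hpq] at k1 k2 k3 k4 k5
    obtain ⟨β, b1, b2, b3, b4, b5⟩ :=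
      (isLink_append.2 ⟨h3, (isLink_append.1 k1).2⟩ : IsLink r b (l ++ h :: q) c).shorten
    refine ⟨k, β, b1, b3, ?_, fun i hi => ⟨hb i, ?_⟩⟩
    · grind
    · have := k4 i hi.symm
      grind
  · obtain ⟨β, b1, b2, b3, b4, b5⟩ := h3.shorten
    exact ⟨0, β, b1, b3, by grind, fun i hi => ⟨hb i, by grind⟩⟩

namespace MGraph

variable {H : MGraph}

theorem Adj.symm {u v : ℕ} (h : H.Adj u v) : H.Adj v u := by
  obtain ⟨e, he, h⟩ := h
  exact ⟨e, he, by rw [h, Sym2.eq_swap]⟩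

theorem IsWalk.subset_V {vs es : List ℕ} (h : H.IsWalk vs es) : ∀ v ∈ vs, v ∈ H.V := by
  induction h with
  | nil hv => simpa using hv
  | cons he hends hw ih =>
    intro w hw'
    rcases List.mem_cons.1 hw' with rfl | h'
    · exact H.ends_mem _ he _ (by simp [hends])
    · exact ih w h'

theorem IsWalk.subset_E {vs es : List ℕ} (h : H.IsWalk vs es) : ∀ e ∈ es, e ∈ H.E := by
  induction h with
  | nil hv => simp
  | cons he hends hw ih => grind

theorem IsWalk.mem_of_mem_ends {vs es : List ℕ} (h : H.IsWalk vs es) :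
    ∀ e ∈ es, ∀ v ∈ H.ends e, v ∈ vs := by
  induction h with
  | nil hv => simp
  | @cons u v e vs es he hends hw ih =>
    intro g hg x hx
    rcases List.mem_cons.1 hg with rfl | h'
    · rw [hends, Sym2.mem_iff] at hx
      grind
    · exact List.mem_cons_of_mem _ (ih g h' x hx)

theorem IsWalk.append {p q es fs : List ℕ} {m n g : ℕ} (hp : H.IsWalk p es)
    (hq : H.IsWalk q fs) (hm : p.getLast? = some m) (hn : q.head? = some n) (hg : g ∈ H.E)
    (hgm : H.ends g = s(m, n)) : H.IsWalk (p ++ q) (es ++ g :: fs) := by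
  induction hp with
  | nil hv =>
    obtain ⟨q', rfl⟩ : ∃ q', q = n :: q' := by
      cases q with
      | nil => simp at hn
      | cons a q => simp at hn; exact ⟨q, by rw [hn]⟩
    simp only [List.getLast?_singleton, Option.some.injEq] at hm
    subst hm
    exact .cons hg hgm hq
  | cons he hends hw ih =>
    exact .cons he hends (ih (by simpa using hm))

theorem IsWalk.nodup_edges {vs es : List ℕ} (h : H.IsWalk vs es) (hvs : vs.Nodup) :
    es.Nodup := by
  induction h with
  | nil hv => simp
  | @cons u v e vs es he hends hw ih =>
    rw [List.nodup_cons] at hvs ⊢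
    exact ⟨fun h => hvs.1 (hw.mem_of_mem_ends e h u (by simp [hends])), ih hvs.2⟩

theorem degIn_insert {C : Finset ℕ} {g u v : ℕ} (hg : g ∉ C) (hguv : H.ends g = s(u, v))
    (huv : u ≠ v) (x : ℕ) : H.degIn (insert g C) x =
      (if x = u then 1 else 0) + (if x = v then 1 else 0) + H.degIn C x := by
  rw [degIn, Finset.sum_insert hg, hguv]
  congr 1
  simp only [Sym2.eq_iff, Sym2.mem_iff]
  grind

theorem IsWalk.degIn_add {vs es : List ℕ} {u w : ℕ} (h : H.IsWalk vs es) (hvs : vs.Nodup)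
    (hu : vs.head? = some u) (hw : vs.getLast? = some w) (x : ℕ) :
    H.degIn es.toFinset x + (if x = u then 1 else 0) + (if x = w then 1 else 0) =
      if x ∈ vs then 2 else 0 := by
  induction h generalizing u with
  | nil hv =>
    simp only [List.head?_cons, Option.some.injEq, List.getLast?_singleton] at hu hw
    subst hu hw
    simp [degIn]
    grind
  | @cons a v e vs es he hends hw' ih =>
    have hn := (IsWalk.cons he hends hw').nodup_edges hvs
    rw [List.nodup_cons] at hvs hn
    have := ih hvs.2 (u := v) rfl (by simpa using hw)
    simp only [List.head?_cons, Option.some.injEq] at hu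
    subst hu
    rw [List.toFinset_cons, degIn_insert (by simpa using hn.1) hends (by grind)]
    grind

theorem IsWalk.reflTransGen {vs es : List ℕ} {u : ℕ} (h : H.IsWalk vs es)
    (hu : vs.head? = some u) : ∀ x ∈ vs,
    Relation.ReflTransGen (fun a b => ∃ e ∈ es, H.ends e = s(a, b)) u x := by
  induction h generalizing u with
  | nil hv =>
    simp only [List.head?_cons, Option.some.injEq] at hu
    simp [hu, Relation.ReflTransGen.refl]
  | @cons a v e vs es he hends hw ih =>
    simp only [List.head?_cons, Option.some.injEq] at hu
    subst hu
    intro x hx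
    rcases List.mem_cons.1 hx with rfl | hx
    · exact .refl
    · refine .head ⟨e, by simp, hends⟩ (Relation.ReflTransGen.mono ?_ _ _ (ih rfl x hx))
      rintro a b ⟨g, hg, h⟩
      exact ⟨g, by simp [hg], h⟩

theorem reflTransGen_symm {C : Finset ℕ} {u v : ℕ}
    (h : Relation.ReflTransGen (fun a b => ∃ e ∈ C, H.ends e = s(a, b)) u v) :
    Relation.ReflTransGen (fun a b => ∃ e ∈ C, H.ends e = s(a, b)) v u := by
  induction h with
  | refl => exact .refl
  | tail _ h ih =>
    obtain ⟨e, he, h⟩ := h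
    exact .head ⟨e, he, by rw [h, Sym2.eq_swap]⟩ ih

theorem IsPathBetween.isCycleSet {vs es : List ℕ} {u w g : ℕ} (h : H.IsPathBetween u w vs es)
    (hg : g ∈ H.E) (hguw : H.ends g = s(u, w)) (huw : u ≠ w) (hges : g ∉ es) :
    H.IsCycleSet (insert g es.toFinset) ∧
      H.vertsOf (insert g es.toFinset) = vs.toFinset := by
  obtain ⟨hw, hn, hu, hl⟩ := h
  have hdeg : ∀ x, H.degIn (insert g es.toFinset) x = if x ∈ vs then 2 else 0 := by
    intro x
    rw [degIn_insert (by simpa using hges) hguw huw, ← hw.degIn_add hn hu hl x]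
    ring
  have huvs : u ∈ vs := List.mem_of_head? hu
  have hwvs : w ∈ vs := List.mem_of_getLast? hl
  have hverts : H.vertsOf (insert g es.toFinset) = vs.toFinset := by
    ext x
    simp only [vertsOf, Finset.mem_filter, List.mem_toFinset]
    constructor
    · rintro ⟨-, e, he, hx⟩
      rcases Finset.mem_insert.1 he with rfl | he
      · rw [hguw, Sym2.mem_iff] at hx
        grind
      · exact hw.mem_of_mem_ends e (by simpa using he) x hx
    · intro hx
      refine ⟨hw.subset_V x hx, ?_⟩
      by_contra! hcon
      have h0 : H.degIn (insert g es.toFinset) x = 0 := by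
        refine Finset.sum_eq_zero fun e he => ?_
        have := hcon e he
        rw [if_neg, if_neg this]
        rintro h
        simp [h] at this
      rw [hdeg, if_pos hx] at h0
      exact absurd h0 (by decide)
  refine ⟨⟨by simp, ?_, ?_, ?_⟩, hverts⟩
  · intro e he
    rcases Finset.mem_insert.1 he with rfl | he
    · exact hg
    · exact hw.subset_E e (by simpa using he)
  · intro v hv
    rw [hverts, List.mem_toFinset] at hv
    rw [hdeg, if_pos hv]
  · have key : ∀ x ∈ vs, Relation.ReflTransGen
        (fun a b => ∃ e ∈ insert g es.toFinset, H.ends e = s(a, b)) u x := by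
      intro x hx
      refine Relation.ReflTransGen.mono ?_ _ _ (hw.reflTransGen hu x hx)
      rintro a b ⟨e, he, h⟩
      exact ⟨e, by simp [he], h⟩
    rw [hverts]
    intro x hx y hy
    exact (reflTransGen_symm (key x (by simpa using hx))).trans (key y (by simpa using hy))

theorem exists_isWalk_of_isLink {x y : ℕ} {l : List ℕ} (h : IsLink H.Adj x l y) :
    ∃ es, H.IsWalk (x :: (l ++ [y])) es := by
  induction l generalizing x with
  | nil =>
    obtain ⟨e, he, hxy⟩ := h
    exact ⟨[e], .cons he hxy (.nil (H.ends_mem e he y (by simp [hxy])))⟩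
  | cons z l ih =>
    obtain ⟨⟨e, he, hxz⟩, h⟩ := h
    obtain ⟨es, hes⟩ := ih h
    exact ⟨e :: es, .cons he hxz hes⟩

theorem exists_isPathBetween {M : Set ℕ} (hM : ConnIn H.Adj M) {x y : ℕ} (hxV : x ∈ H.V)
    (hx : x ∈ M) (hy : y ∈ M) :
    ∃ vs es, H.IsPathBetween x y vs es ∧ ∀ v ∈ vs, v ∈ M := by
  by_cases hxy : x = y
  · subst hxy
    exact ⟨[x], [], ⟨.nil hxV, by simp, rfl, rfl⟩, by simpa using hx⟩
  obtain ⟨h, l, h1, h2, h3, h4⟩ := hM.exists_isLink (X := {y}) hx (by simpa using hxy) hy rfl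
  simp only [Set.mem_singleton_iff] at h2 h4
  subst h2
  obtain ⟨l', k1, k2, k3, k4, k5⟩ := h3.shorten
  obtain ⟨es, hes⟩ := exists_isWalk_of_isLink k1
  refine ⟨_, es, ⟨hes, ?_, rfl, by rw [← List.cons_append, List.getLast?_append]; rfl⟩, by grind⟩
  grind

/-- Two edges between disjoint connected sets lie on a common cycle within their union. -/
theorem exists_isCycleSet {M N : Set ℕ} (hM : ConnIn H.Adj M) (hN : ConnIn H.Adj N)
    (hMN : Disjoint M N) {g₁ g₂ m₁ m₂ n₁ n₂ : ℕ} (hg₁ : g₁ ∈ H.E) (hg₂ : g₂ ∈ H.E)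
    (hg : g₁ ≠ g₂) (h₁ : H.ends g₁ = s(m₁, n₁)) (h₂ : H.ends g₂ = s(m₂, n₂)) (hm₁ : m₁ ∈ M)
    (hm₂ : m₂ ∈ M) (hn₁ : n₁ ∈ N) (hn₂ : n₂ ∈ N) :
    ∃ C, H.IsCycleSet C ∧ (∀ v ∈ H.vertsOf C, v ∈ M ∨ v ∈ N) ∧ m₁ ∈ H.vertsOf C ∧
      m₂ ∈ H.vertsOf C ∧ n₁ ∈ H.vertsOf C ∧ n₂ ∈ H.vertsOf C := by
  have hdis : ∀ v ∈ M, v ∉ N := fun v h h' => Set.disjoint_left.1 hMN h h'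
  obtain ⟨p, es, ⟨p1, p2, p3, p4⟩, p5⟩ :=
    exists_isPathBetween hM (H.ends_mem g₁ hg₁ m₁ (by simp [h₁])) hm₁ hm₂
  obtain ⟨q, fs, ⟨q1, q2, q3, q4⟩, q5⟩ :=
    exists_isPathBetween hN (H.ends_mem g₂ hg₂ n₂ (by simp [h₂])) hn₂ hn₁
  have hw := p1.append q1 p4 q3 hg₂ h₂
  have hpath : H.IsPathBetween m₁ n₁ (p ++ q) (es ++ g₂ :: fs) := by
    refine ⟨hw, List.nodup_append.2 ⟨p2, q2, ?_⟩, by simp [p3], by simp [q4]⟩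
    intro a ha b hb hab
    exact hdis a (p5 a ha) (hab ▸ q5 b hb)
  have hges : g₁ ∉ es ++ g₂ :: fs := by
    simp only [List.mem_append, List.mem_cons, not_or]
    refine ⟨fun h => ?_, hg, fun h => ?_⟩
    · exact hdis n₁ (p5 _ (p1.mem_of_mem_ends g₁ h n₁ (by simp [h₁]))) hn₁
    · exact hdis m₁ hm₁ (q5 _ (q1.mem_of_mem_ends g₁ h m₁ (by simp [h₁])))
  obtain ⟨hC, hV⟩ := hpath.isCycleSet hg₁ h₁ (fun h => hdis m₁ hm₁ (h ▸ hn₁)) hges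
  refine ⟨_, hC, ?_, ?_, ?_, ?_, ?_⟩ <;> rw [hV]
  · intro v hv
    rcases List.mem_append.1 (List.mem_toFinset.1 hv) with h | h
    · exact .inl (p5 v h)
    · exact .inr (q5 v h)
  · simp [List.mem_of_head? p3]
  · simp [List.mem_of_getLast? p4]
  · simp [List.mem_of_getLast? q4]
  · simp [List.mem_of_head? q3]

end MGraph

namespace MGraph

variable {H : MGraph}

/-- Every cut separating the vertex set has at least three edges. -/
def CutsGeThree (H : MGraph) : Prop :=
  ∀ X : Set ℕ, (∃ v ∈ H.V, v ∈ X) → (∃ v ∈ H.V, v ∉ X) →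
    ∃ g x y : Fin 3 → ℕ, Function.Injective g ∧
      ∀ i, g i ∈ H.E ∧ H.ends (g i) = s(x i, y i) ∧ x i ∈ X ∧ y i ∉ X

theorem cmapOn_eq_iff {U : Finset ℕ} (hU : U ⊆ H.V) {v w : ℕ} :
    H.cmapOn U v = H.cmapOn U w ↔ v = w ∨ v ∈ U ∧ w ∈ U := by
  rw [cmapOn, cmapOn, Finset.inter_eq_left.2 hU]
  have key : ∀ v ∈ U, sInf {w : ℕ | w ∈ U} ∈ U :=
    fun v hv => Nat.sInf_mem (s := {w | w ∈ U}) ⟨v, hv⟩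
  by_cases hv : v ∈ U <;> by_cases hw : w ∈ U <;> simp only [hv, hw, if_true, if_false]
  · simp
  · have := key v hv
    grind
  · have := key w hw
    grind
  · simp

theorem vertsOf_subset (C : Finset ℕ) : H.vertsOf C ⊆ H.V := Finset.filter_subset _ _

theorem contractCycle_V (C : Finset ℕ) :
    (H.contractCycle C).V = H.V.image (H.cmapOn (H.vertsOf C)) := rfl

theorem contractCycle_ends (C : Finset ℕ) (g : ℕ) :
    (H.contractCycle C).ends g = (H.ends g).map (H.cmapOn (H.vertsOf C)) := rfl

theorem Loopless.ne_of_ends (hH : H.Loopless) {g x y : ℕ} (hg : g ∈ H.E)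
    (hxy : H.ends g = s(x, y)) : x ≠ y := by
  rintro rfl
  exact hH g hg (by simp [hxy])

theorem Loopless.mem_contractCycle (hH : H.Loopless) {C : Finset ℕ} {g x y : ℕ}
    (hxy : H.ends g = s(x, y)) : g ∈ (H.contractCycle C).E ↔
      g ∈ H.E ∧ H.cmapOn (H.vertsOf C) x ≠ H.cmapOn (H.vertsOf C) y := by
  simp only [contractCycle, contractOn, Finset.mem_filter]
  refine and_congr_right fun hg => ?_
  rw [Ne, cmapOn_eq_iff (vertsOf_subset C), hxy]
  have := hH.ne_of_ends hg hxy
  simp [this]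

theorem exists_ends (H : MGraph) (g : ℕ) : ∃ x y, H.ends g = s(x, y) := by
  induction h : H.ends g using Sym2.ind with
  | _ x y => exact ⟨x, y, rfl⟩

theorem Loopless.contractCycle (hH : H.Loopless) (C : Finset ℕ) :
    (H.contractCycle C).Loopless := by
  intro g hg
  obtain ⟨x, y, hxy⟩ := H.exists_ends g
  rw [hH.mem_contractCycle hxy] at hg
  rw [contractCycle_ends, hxy]
  simpa using hg.2

theorem CutsGeThree.contractCycle (hH : H.Loopless) (hc : H.CutsGeThree) (C : Finset ℕ) :
    (H.contractCycle C).CutsGeThree := by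
  set φ := H.cmapOn (H.vertsOf C) with hφ
  rintro X ⟨v, hv, hvX⟩ ⟨w, hw, hwX⟩
  rw [contractCycle_V, Finset.mem_image] at hv hw
  obtain ⟨v, hv, rfl⟩ := hv
  obtain ⟨w, hw, rfl⟩ := hw
  obtain ⟨g, x, y, hg, h⟩ := hc (φ ⁻¹' X) ⟨v, hv, hvX⟩ ⟨w, hw, hwX⟩
  refine ⟨g, φ ∘ x, φ ∘ y, hg, fun i => ?_⟩
  obtain ⟨h1, h2, h3, h4⟩ := h i
  refine ⟨(hH.mem_contractCycle h2).2 ⟨h1, fun h => ?_⟩, ?_, h3, h4⟩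
  · rw [Set.mem_preimage, hφ, ← h] at h4
    exact h4 h3
  · rw [contractCycle_ends, h2]
    rfl

theorem Loopless.adj_contractCycle (hH : H.Loopless) {C : Finset ℕ} {x y : ℕ}
    (h : H.Adj x y) : H.cmapOn (H.vertsOf C) x = H.cmapOn (H.vertsOf C) y ∨
      (H.contractCycle C).Adj (H.cmapOn (H.vertsOf C) x) (H.cmapOn (H.vertsOf C) y) := by
  obtain ⟨g, hg, hxy⟩ := h
  by_cases heq : H.cmapOn (H.vertsOf C) x = H.cmapOn (H.vertsOf C) y
  · exact .inl heq
  · exact .inr ⟨g, (hH.mem_contractCycle hxy).2 ⟨hg, heq⟩, by rw [contractCycle_ends, hxy]; rfl⟩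

theorem Loopless.connIn_contractCycle (hH : H.Loopless) (C : Finset ℕ) {A : Set ℕ}
    (hA : ConnIn H.Adj A) :
    ConnIn (H.contractCycle C).Adj (H.cmapOn (H.vertsOf C) '' A) := by
  rintro _ ⟨x, hx, rfl⟩ _ ⟨y, hy, rfl⟩
  have h := hA x hx y hy
  clear hy
  induction h with
  | refl => exact .refl
  | tail _ h ih =>
    rcases hH.adj_contractCycle (C := C) h.1 with h' | h'
    · rwa [← h']
    · exact ih.tail ⟨h', Set.mem_image_of_mem _ h.2⟩

theorem Loopless.card_contractCycle_lt (hH : H.Loopless) {C : Finset ℕ}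
    (hC : H.IsCycleSet C) : (H.contractCycle C).V.card < H.V.card := by
  obtain ⟨g, hg⟩ := hC.1
  have hgE := hC.2.1 hg
  obtain ⟨x, y, hxy⟩ := H.exists_ends g
  have hx : x ∈ H.vertsOf C := Finset.mem_filter.2
    ⟨H.ends_mem g hgE x (by simp [hxy]), g, hg, by simp [hxy]⟩
  have hy : y ∈ H.vertsOf C := Finset.mem_filter.2
    ⟨H.ends_mem g hgE y (by simp [hxy]), g, hg, by simp [hxy]⟩
  rw [contractCycle_V]
  refine lt_of_le_of_ne Finset.card_image_le fun h => ?_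
  have := Finset.card_image_iff.1 h (vertsOf_subset C hx) (vertsOf_subset C hy)
    ((cmapOn_eq_iff (vertsOf_subset C)).2 (.inr ⟨hx, hy⟩))
  exact hH.ne_of_ends hgE hxy this

/-- The three possible shapes of a terminal graph containing `e` and `f`. -/
def IsTerminal (H : MGraph) (e f : ℕ) : Prop :=
  (∃ n, 3 ≤ n ∧ H.IsBondGraph n) ∨
    (∃ u vs pE S, IsFanType H u vs pE S ∧
      e ∈ S vs.head! ∧ f ∈ S vs.getLast! ∧ e ≠ f ∧ H.ends e ≠ H.ends f) ∨
    (∃ H', IsSimplification H H' ∧ e ∈ H'.E ∧ f ∈ H'.E ∧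
      (∀ x, x ∈ H.ends e → x ∉ H.ends f) ∧ IsK4 H' ∧
      (∀ g ∈ H.E, H.ends g ≠ H.ends e → H.ends g ≠ H.ends f →
        ∀ h ∈ H.E, h ≠ g → H.ends h ≠ H.ends g))

/-- `H` has a cc-minor containing `e` and `f` of one of the three terminal shapes. -/
def HasTerminal (H : MGraph) (e f : ℕ) : Prop :=
  ∃ K, H.CCMinor K ∧ e ∈ K.E ∧ f ∈ K.E ∧ K.IsTerminal e f

theorem HasTerminal.of_contractCycle {C : Finset ℕ} {e f : ℕ} (hC : H.IsCycleSet C)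
    (h : (H.contractCycle C).HasTerminal e f) : H.HasTerminal e f := by
  obtain ⟨K, h1, h2⟩ := h
  exact ⟨K, .head ⟨C, hC, rfl⟩ h1, h2⟩

/-- The edges `e` and `f` join a hub `u` to a connected set avoiding `u`. -/
def HasHub (H : MGraph) (e f : ℕ) : Prop :=
  e ∈ H.E ∧ f ∈ H.E ∧ ∃ u b d, ∃ Q : Set ℕ, H.ends e = s(u, b) ∧ H.ends f = s(u, d) ∧
    ConnIn H.Adj Q ∧ Q ⊆ H.V ∧ u ∉ Q ∧ b ∈ Q ∧ d ∈ Q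

theorem Loopless.hasHub_contractCycle (hH : H.Loopless) {C : Finset ℕ} {e f u u' b d : ℕ}
    {Q : Set ℕ} (he : e ∈ H.E) (hf : f ∈ H.E) (heub : H.ends e = s(u, b))
    (hfud : H.ends f = s(u', d)) (hQ : ConnIn H.Adj Q) (hQV : Q ⊆ H.V) (hb : b ∈ Q)
    (hd : d ∈ Q) (huu : u = u' ∨ u ∈ H.vertsOf C ∧ u' ∈ H.vertsOf C)
    (hu : ∀ q ∈ Q, q ≠ u ∧ ¬ (u ∈ H.vertsOf C ∧ q ∈ H.vertsOf C))
    (hu' : ∀ q ∈ Q, q ≠ u' ∧ ¬ (u' ∈ H.vertsOf C ∧ q ∈ H.vertsOf C)) :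
    (H.contractCycle C).HasHub e f := by
  have hφ := fun v w => cmapOn_eq_iff (H := H) (vertsOf_subset C) (v := v) (w := w)
  have huu' := (hφ _ _).2 huu
  refine ⟨(hH.mem_contractCycle heub).2 ⟨he, ?_⟩, (hH.mem_contractCycle hfud).2 ⟨hf, ?_⟩,
    H.cmapOn (H.vertsOf C) u, _, _, _, ?_, ?_, hH.connIn_contractCycle C hQ, ?_, ?_,
    Set.mem_image_of_mem _ hb, Set.mem_image_of_mem _ hd⟩
  · rw [Ne, hφ]
    grind
  · rw [Ne, hφ]
    grind
  · rw [contractCycle_ends, heub]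
    rfl
  · rw [contractCycle_ends, hfud, huu']
    rfl
  · rintro _ ⟨q, hq, rfl⟩
    exact Finset.mem_coe.2 (Finset.mem_image_of_mem _ (hQV hq))
  · rintro ⟨q, hq, h⟩
    rw [hφ] at h
    grind

end MGraph

theorem connIn_singleton (r : ℕ → ℕ → Prop) (x : ℕ) : ConnIn r {x} := by
  rintro _ rfl _ rfl
  exact .refl

theorem ConnIn.union {r : ℕ → ℕ → Prop} (hr : ∀ x y, r x y → r y x) {A B : Set ℕ}
    (hA : ConnIn r A) (hB : ConnIn r B) {a b : ℕ} (ha : a ∈ A) (hb : b ∈ B) (hab : r a b) :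
    ConnIn r (A ∪ B) := by
  have hA' : ∀ x ∈ A, ∀ y ∈ A, Relation.ReflTransGen (fun p q => r p q ∧ q ∈ A ∪ B) x y :=
    fun x hx y hy => Relation.ReflTransGen.mono (fun p q h => ⟨h.1, .inl h.2⟩) _ _ (hA x hx y hy)
  have hB' : ∀ x ∈ B, ∀ y ∈ B, Relation.ReflTransGen (fun p q => r p q ∧ q ∈ A ∪ B) x y :=
    fun x hx y hy => Relation.ReflTransGen.mono (fun p q h => ⟨h.1, .inr h.2⟩) _ _ (hB x hx y hy)
  rintro x (hx | hx) y (hy | hy)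
  · exact hA' x hx y hy
  · exact ((hA' x hx a ha).tail ⟨hab, .inr hb⟩).trans (hB' b hb y hy)
  · exact ((hB' x hx b hb).tail ⟨hr _ _ hab, .inl ha⟩).trans (hA' a ha y hy)
  · exact hB' x hx y hy

theorem exists_component {r : ℕ → ℕ → Prop} (hr : ∀ x y, r x y → r y x) {R : Set ℕ} {w : ℕ}
    (hw : w ∈ R) : ∃ M : Set ℕ, w ∈ M ∧ M ⊆ R ∧ ConnIn r M ∧
      ∀ x ∈ M, ∀ y ∈ R, r x y → y ∈ M := by
  let M : Set ℕ := {v | Relation.ReflTransGen (fun p q => r p q ∧ q ∈ R) w v}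
  have hMR : M ⊆ R := by
    intro v hv
    rcases Relation.ReflTransGen.cases_tail hv with rfl | ⟨_, _, h⟩
    · exact hw
    · exact h.2
  have h1 : ∀ v ∈ M, Relation.ReflTransGen (fun p q => r p q ∧ q ∈ M) w v := by
    intro v hv
    induction hv with
    | refl => exact .refl
    | tail hp h ih => exact ih.tail ⟨h.1, Relation.ReflTransGen.tail hp h⟩
  have h2 : ∀ v ∈ M, Relation.ReflTransGen (fun p q => r p q ∧ q ∈ M) v w := by
    intro v hv
    induction hv with
    | refl => exact .refl
    | tail hp h ih => exact .head ⟨hr _ _ h.1, hp⟩ ih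
  exact ⟨M, .refl, hMR, fun x hx y hy => (h2 x hx).trans (h1 y hy),
    fun x hx y hy hxy => Relation.ReflTransGen.tail hx ⟨hxy, hy⟩⟩

namespace MGraph

variable {H : MGraph}

theorem IsWalk.connIn {vs es : List ℕ} (h : H.IsWalk vs es) : ConnIn H.Adj {v | v ∈ vs} := by
  induction h with
  | nil hv => simpa using connIn_singleton _ _
  | @cons u v e vs es he hends hw ih =>
    have := (connIn_singleton H.Adj u).union (fun _ _ h => h.symm) ih rfl (b := v) (by simp)
      ⟨e, he, hends⟩
    convert this using 1
    ext
    simp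

theorem IsWalk.getElem {vs es : List ℕ} (h : H.IsWalk vs es) :
    es.length + 1 = vs.length ∧ ∀ i : ℕ, i + 1 < vs.length →
      es[i]! ∈ H.E ∧ H.ends es[i]! = s(vs[i]!, vs[i + 1]!) := by
  induction h with
  | nil hv => simp
  | @cons u v e vs es he hends hw ih =>
    refine ⟨by simpa using ih.1, fun i hi => ?_⟩
    cases i with
    | zero => simpa using ⟨he, hends⟩
    | succ i => simpa using ih.2 i (by simpa using hi)

theorem IsWalk.exists_isCycleSet {vs es : List ℕ} (h : H.IsWalk vs es) (hvs : vs.Nodup)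
    {g x y : ℕ} (hg : g ∈ H.E) (hxy : H.ends g = s(x, y)) (hne : x ≠ y) (hx : x ∈ vs)
    (hy : y ∈ vs) (hges : g ∉ es) :
    ∃ C, H.IsCycleSet C ∧ ∀ v ∈ H.vertsOf C, v ∈ vs := by
  induction h with
  | nil hv => grind
  | @cons u v e vs es he hends hw ih =>
    have hdisj : Disjoint ({u} : Set ℕ) {w | w ∈ v :: vs} := by
      rw [Set.disjoint_singleton_left]
      exact (List.nodup_cons.1 hvs).1
    have key : ∀ z ∈ v :: vs, H.ends g = s(u, z) →
        ∃ C, H.IsCycleSet C ∧ ∀ w ∈ H.vertsOf C, w ∈ u :: v :: vs := by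
      intro z hz huz
      obtain ⟨C, hC, h1, -⟩ := MGraph.exists_isCycleSet (connIn_singleton H.Adj u)
        hw.connIn hdisj hg he
        (by grind) huz hends rfl rfl hz (by simp)
      refine ⟨C, hC, fun w hw => ?_⟩
      rcases h1 w hw with rfl | h
      · simp
      · exact List.mem_cons_of_mem _ h
    rcases List.mem_cons.1 hx with rfl | hx'
    · exact key y (by grind) hxy
    rcases List.mem_cons.1 hy with rfl | hy'
    · exact key x hx' (by rw [hxy, Sym2.eq_swap])
    obtain ⟨C, hC, h1⟩ := ih (List.nodup_cons.1 hvs).2 hx' hy' (by grind)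
    exact ⟨C, hC, fun w hw => List.mem_cons_of_mem _ (h1 w hw)⟩

theorem CutsGeThree.three_le_card (hc : H.CutsGeThree) {u v : ℕ} (hu : u ∈ H.V) (hv : v ∈ H.V)
    (huv : u ≠ v) : 3 ≤ H.E.card := by
  obtain ⟨g, x, y, hg, h⟩ := hc {u} ⟨u, hu, rfl⟩ ⟨v, hv, huv.symm⟩
  calc 3 = (Finset.univ.image g).card := by rw [Finset.card_image_of_injective _ hg]; rfl
    _ ≤ _ := Finset.card_le_card (by simpa [Finset.image_subset_iff] using fun i => (h i).1)

theorem three_le_degIn {C : Finset ℕ} {w : ℕ} {g : Fin 3 → ℕ} (hg : Function.Injective g)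
    (h : ∀ i, g i ∈ C ∧ w ∈ H.ends (g i)) : 3 ≤ H.degIn C w := by
  calc 3 = ∑ e ∈ Finset.univ.image g, 1 := by
        rw [Finset.sum_const, Finset.card_image_of_injective _ hg]; rfl
    _ ≤ ∑ e ∈ Finset.univ.image g,
        (if H.ends e = s(w, w) then 2 else if w ∈ H.ends e then 1 else 0) := by
        refine Finset.sum_le_sum fun e he => ?_
        obtain ⟨i, -, rfl⟩ := Finset.mem_image.1 he
        rw [if_pos (h i).2]
        split_ifs <;> simp
    _ ≤ _ := Finset.sum_le_sum_of_subset
        (by simpa [Finset.image_subset_iff] using fun i => (h i).1)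

theorem IsPathBetween.isTerminal (hH : H.Loopless) (hc : H.CutsGeThree) {e f u b d : ℕ}
    (hef : e ≠ f) (he : e ∈ H.E) (hf : f ∈ H.E) (heub : H.ends e = s(u, b))
    (hfud : H.ends f = s(u, d)) {vs es : List ℕ} (h : H.IsPathBetween b d vs es)
    (hu : u ∉ vs) (hV : ∀ v ∈ H.V, v = u ∨ v ∈ vs)
    (hcyc : ∀ C, H.IsCycleSet C → u ∈ H.vertsOf C) : H.IsTerminal e f := by
  obtain ⟨hw, hn, hb, hd⟩ := h
  have hbvs : b ∈ vs := List.mem_of_head? hb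
  have hdvs : d ∈ vs := List.mem_of_getLast? hd
  have huV : u ∈ H.V := H.ends_mem e he u (by simp [heub])
  have hvsV : ∀ v ∈ vs, v ∈ H.V := hw.subset_V
  have hchord : ∀ g ∈ H.E, ∀ x y, H.ends g = s(x, y) → x ∈ vs → y ∈ vs → g ∈ es := by
    intro g hg x y hxy hx hy
    by_contra hges
    obtain ⟨C, hC, h1⟩ := hw.exists_isCycleSet hn hg hxy (hH.ne_of_ends hg hxy) hx hy hges
    exact hu (h1 u (hcyc C hC))
  obtain ⟨v₀, vs', rfl⟩ : ∃ v vs', vs = v :: vs' := List.exists_cons_of_ne_nil (by grind)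
  obtain rfl : v₀ = b := by simpa using hb
  by_cases hbd : v₀ = d
  · subst hbd
    obtain rfl : vs' = [] := by
      rcases List.eq_nil_or_concat vs' with rfl | ⟨l, z, rfl⟩
      · rfl
      · simp at hd
        grind
    refine .inl ⟨_, hc.three_le_card huV (hvsV _ hbvs) (by grind), u, v₀, by grind, ?_, rfl, ?_⟩
    · ext v
      have := hV v
      grind
    · intro g hg
      obtain ⟨x, y, hxy⟩ := H.exists_ends g
      have h1 := hV x (H.ends_mem g hg x (by simp [hxy]))
      have h2 := hV y (H.ends_mem g hg y (by simp [hxy]))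
      have h3 := hH.ne_of_ends hg hxy
      rw [hxy, Sym2.eq_iff]
      grind
  refine .inr (.inl ⟨u, v₀ :: vs', es, fun w => H.E.filter (fun g => H.ends g = s(u, w)),
    ⟨by simp, hn, hu, ?_, hw.getElem.1, hw.nodup_edges hn, hw.getElem.2, ?_, ?_⟩, ?_, ?_, hef, ?_⟩)
  · ext v
    have := hV v
    have := hvsV v
    rw [Finset.mem_insert, List.mem_toFinset]
    grind
  · intro w hwvs
    refine ⟨?_, fun g hg => Finset.mem_filter.1 hg⟩
    by_cases hwb : w = v₀
    · exact ⟨e, Finset.mem_filter.2 ⟨he, by rw [heub, hwb]⟩⟩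
    by_cases hwd : w = d
    · exact ⟨f, Finset.mem_filter.2 ⟨hf, by rw [hfud, hwd]⟩⟩
    by_contra hemp
    rw [Finset.not_nonempty_iff_eq_empty, Finset.filter_eq_empty_iff] at hemp
    obtain ⟨g, x, y, hg, h⟩ := hc {w} ⟨w, hvsV w hwvs, rfl⟩ ⟨u, huV, by simp; grind⟩
    have hdeg := hw.degIn_add hn hb hd w
    rw [if_neg hwb, if_neg hwd, if_pos hwvs] at hdeg
    have : 3 ≤ H.degIn es.toFinset w := by
      refine three_le_degIn hg fun i => ?_
      obtain ⟨h1, h2, h3, -⟩ := h i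
      obtain rfl : x i = w := h3
      refine ⟨?_, by simp [h2]⟩
      rcases hV (y i) (H.ends_mem _ h1 _ (by simp [h2])) with hy | hy
      · exact absurd (by rw [h2, hy, Sym2.eq_swap]) (hemp h1)
      · simpa using hchord _ h1 _ _ h2 hwvs hy
    omega
  · ext g
    simp only [Finset.mem_union, Finset.mem_biUnion, List.mem_toFinset, Finset.mem_filter]
    refine ⟨fun hg => ?_, ?_⟩
    · obtain ⟨x, y, hxy⟩ := H.exists_ends g
      have h1 := hV x (H.ends_mem g hg x (by simp [hxy]))
      have h2 := hV y (H.ends_mem g hg y (by simp [hxy]))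
      have h3 := hH.ne_of_ends hg hxy
      rcases h1 with rfl | h1
      · exact .inr ⟨y, by grind, hg, hxy⟩
      rcases h2 with rfl | h2
      · exact .inr ⟨x, by grind, hg, by rw [hxy, Sym2.eq_swap]⟩
      exact .inl (hchord g hg x y hxy h1 h2)
    · rintro (hg | ⟨w, -, hg, -⟩)
      · exact hw.subset_E g hg
      · exact hg
  · exact Finset.mem_filter.2 ⟨he, heub⟩
  · refine Finset.mem_filter.2 ⟨hf, ?_⟩
    rw [List.getLast!_eq_getLast?_getD, hd]
    exact hfud
  · rw [heub, hfud]
    simp only [ne_eq, Sym2.eq_iff]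
    grind

theorem HasHub.hasTerminal {e f : ℕ} (hef : e ≠ f) (h : H.HasHub e f) (hH : H.Loopless)
    (hc : H.CutsGeThree) : H.HasTerminal e f := by
  induction hn : H.V.card using Nat.strong_induction_on generalizing H with
  | _ n ih =>
    subst hn
    replace ih : ∀ C, H.IsCycleSet C → (H.contractCycle C).HasHub e f → H.HasTerminal e f :=
      fun C hC hhub => .of_contractCycle hC
        (ih _ (hH.card_contractCycle_lt hC) hhub (hH.contractCycle C) (hc.contractCycle hH C) rfl)
    obtain ⟨he, hf, u, b, d, Q, heub, hfud, hQ, hQV, huQ, hb, hd⟩ := h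
    obtain ⟨vs, es, hpath, hvsQ⟩ := exists_isPathBetween hQ (hQV hb) hb hd
    have hu : u ∉ vs := fun h => huQ (hvsQ u h)
    have hconn := hpath.1.connIn
    have hsub : {v | v ∈ vs} ⊆ (H.V : Set ℕ) := fun v hv => hpath.1.subset_V v hv
    have hbvs : b ∈ vs := List.mem_of_head? hpath.2.2.1
    have hdvs : d ∈ vs := List.mem_of_getLast? hpath.2.2.2
    by_contra hno
    have hcyc : ∀ C, H.IsCycleSet C → (∀ v ∈ vs, ¬ (u ∈ H.vertsOf C ∧ v ∈ H.vertsOf C)) →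
        False := by
      intro C hC h
      refine hno (ih C hC (hH.hasHub_contractCycle he hf heub hfud hconn hsub hbvs hdvs
        (.inl rfl) ?_ ?_)) <;> exact fun q hq => ⟨fun h => hu (h ▸ hq), h q hq⟩
    have hV : ∀ v ∈ H.V, v = u ∨ v ∈ vs := by
      by_contra! hcon
      obtain ⟨w, hwV, hwu, hwvs⟩ := hcon
      obtain ⟨M, hwM, hMR, hM, hMmax⟩ := exists_component (r := H.Adj) (fun _ _ h => h.symm)
        (R := {v | v ∈ H.V ∧ v ≠ u ∧ v ∉ vs}) (w := w) ⟨hwV, hwu, hwvs⟩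
      have hMu : u ∉ M := fun h => (hMR h).2.1 rfl
      obtain ⟨g, x, y, hg, h⟩ := hc M ⟨w, hwV, hwM⟩
        ⟨u, H.ends_mem e he u (by simp [heub]), hMu⟩
      have hy : ∀ i, y i = u ∨ y i ∈ vs := by
        intro i
        obtain ⟨h1, h2, h3, h4⟩ := h i
        by_contra! hcon
        exact h4 (hMmax _ h3 _ ⟨H.ends_mem _ h1 _ (by simp [h2]), hcon⟩ ⟨_, h1, h2⟩)
      have hpig : ∃ i j, i ≠ j ∧ ((y i = u ∧ y j = u) ∨ (y i ∈ vs ∧ y j ∈ vs)) := by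
        have h0 := hy 0
        have h1 := hy 1
        have h2 := hy 2
        have h01 : (0 : Fin 3) ≠ 1 := by decide
        have h02 : (0 : Fin 3) ≠ 2 := by decide
        have h12 : (1 : Fin 3) ≠ 2 := by decide
        grind
      obtain ⟨i, j, hij, hij'⟩ := hpig
      obtain ⟨i1, i2, i3, -⟩ := h i
      obtain ⟨j1, j2, j3, -⟩ := h j
      rcases hij' with ⟨hi, hj⟩ | ⟨hi, hj⟩
      · obtain ⟨C, hC, hCV, -⟩ := exists_isCycleSet hM (connIn_singleton H.Adj u)
          (by simpa using hMu) i1 j1 (fun h => hij (hg h)) i2 j2 i3 j3 hi hj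
        refine hcyc C hC fun v hv ⟨_, hvC⟩ => ?_
        rcases hCV v hvC with h | h
        · exact (hMR h).2.2 hv
        · exact hu ((show v = u from h) ▸ hv)
      · obtain ⟨C, hC, hCV, -⟩ := exists_isCycleSet hM hconn
          (Set.disjoint_left.2 fun v hv => (hMR hv).2.2) i1 j1 (fun h => hij (hg h)) i2 j2 i3 j3
          hi hj
        refine hcyc C hC fun v hv ⟨huC, _⟩ => ?_
        rcases hCV u huC with h | h
        · exact hMu h
        · exact hu h
    refine hno ⟨H, .refl, he, hf, hpath.isTerminal hH hc hef he hf heub hfud hu hV ?_⟩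
    intro C hC
    by_contra huC
    exact hcyc C hC fun v hv h => huC h.1

end MGraph

/-- A link from `x` to `y` recorded by the connected, possibly empty, set `S` of its interior
vertices. -/
def SetLink (r : ℕ → ℕ → Prop) (S : Set ℕ) (x y : ℕ) : Prop :=
  (S = ∅ ∧ r x y) ∨ (ConnIn r S ∧ (∃ p ∈ S, r x p) ∧ ∃ q ∈ S, r q y)

theorem IsLink.connIn {r : ℕ → ℕ → Prop} (hr : ∀ x y, r x y → r y x) {x y : ℕ} {l : List ℕ}
    (h : IsLink r x l y) : ConnIn r {v | v ∈ l} := by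
  induction l generalizing x with
  | nil => intro v hv; simp at hv
  | cons z l ih =>
    cases l with
    | nil => simpa using connIn_singleton r z
    | cons w l =>
      convert (connIn_singleton r z).union hr (ih h.2) rfl (b := w) (by simp) h.2.1 using 1
      ext
      simp

theorem IsLink.exists_adj_right {r : ℕ → ℕ → Prop} {x y : ℕ} {l : List ℕ} (h : IsLink r x l y)
    (hl : l ≠ []) : ∃ q ∈ l, r q y := by
  obtain ⟨l', z, rfl⟩ := List.eq_nil_or_concat l |>.resolve_left hl
  rw [List.concat_eq_append, isLink_append] at h
  exact ⟨z, by simp, h.2⟩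

theorem IsLink.setLink {r : ℕ → ℕ → Prop} (hr : ∀ x y, r x y → r y x) {x y : ℕ} {l : List ℕ}
    (h : IsLink r x l y) : SetLink r {v | v ∈ l} x y := by
  cases hl : l with
  | nil => subst hl; exact .inl ⟨by simp, h⟩
  | cons z l' =>
    rw [← hl]
    refine .inr ⟨h.connIn hr, ?_, h.exists_adj_right (by simp [hl])⟩
    subst hl
    exact ⟨z, by simp, h.1⟩

theorem SetLink.connIn {r : ℕ → ℕ → Prop} (hr : ∀ x y, r x y → r y x) {S : Set ℕ} {x y : ℕ}
    (h : SetLink r S x y) : ConnIn r ({x, y} ∪ S) := by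
  rcases h with ⟨rfl, h⟩ | ⟨h, ⟨p, hp, hxp⟩, q, hq, hqy⟩
  · rw [Set.union_empty]
    exact (connIn_singleton r x).union hr (connIn_singleton r y) rfl rfl h
  · have h1 := (connIn_singleton r x).union hr h rfl hp hxp
    convert h1.union hr (connIn_singleton r y) (.inr hq) rfl hqy using 1
    ext
    simp
    tauto

theorem SetLink.insert {r : ℕ → ℕ → Prop} (hr : ∀ x y, r x y → r y x) {S : Set ℕ} {x y : ℕ}
    (h : SetLink r S x y) {v p : ℕ} (hp : p ∈ S) (hvp : r v p) :
    SetLink r (insert v S) x y := by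
  rcases h with ⟨rfl, h⟩ | ⟨h, ⟨p', hp', hxp⟩, q, hq, hqy⟩
  · simp at hp
  · exact .inr ⟨(connIn_singleton r v).union hr h rfl hp hvp, ⟨p', .inr hp', hxp⟩,
      q, .inr hq, hqy⟩

namespace MGraph

variable {H : MGraph}

/-- The edges `e` and `f` are the crossing chords `ab` and `cd` of a cycle of four segments
with corners `a`, `c`, `b`, `d` in this order. -/
structure SegCycle (H : MGraph) (e f a c b d : ℕ) (S₁ S₂ S₃ S₄ : Set ℕ) : Prop where
  memE : e ∈ H.E ∧ f ∈ H.E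
  chords : (H.ends e = s(a, b) ∧ H.ends f = s(c, d)) ∨ (H.ends f = s(a, b) ∧ H.ends e = s(c, d))
  link₁ : SetLink H.Adj S₁ a c
  link₂ : SetLink H.Adj S₂ c b
  link₃ : SetLink H.Adj S₃ b d
  link₄ : SetLink H.Adj S₄ d a
  corners : a ≠ b ∧ a ≠ c ∧ a ≠ d ∧ b ≠ c ∧ b ≠ d ∧ c ≠ d
  seg₁ : ∀ v ∈ S₁, v ∈ H.V ∧ v ≠ a ∧ v ≠ b ∧ v ≠ c ∧ v ≠ d ∧ v ∉ S₂ ∧ v ∉ S₃ ∧ v ∉ S₄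
  seg₂ : ∀ v ∈ S₂, v ∈ H.V ∧ v ≠ a ∧ v ≠ b ∧ v ≠ c ∧ v ≠ d ∧ v ∉ S₃ ∧ v ∉ S₄
  seg₃ : ∀ v ∈ S₃, v ∈ H.V ∧ v ≠ a ∧ v ≠ b ∧ v ≠ c ∧ v ≠ d ∧ v ∉ S₄
  seg₄ : ∀ v ∈ S₄, v ∈ H.V ∧ v ≠ a ∧ v ≠ b ∧ v ≠ c ∧ v ≠ d

variable {e f a c b d : ℕ} {S₁ S₂ S₃ S₄ : Set ℕ}

theorem SegCycle.rotate (h : H.SegCycle e f a c b d S₁ S₂ S₃ S₄) :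
    H.SegCycle e f c b d a S₂ S₃ S₄ S₁ := by
  obtain ⟨h1, h2, l1, l2, l3, l4, h3, s1, s2, s3, s4⟩ := h
  refine ⟨h1, ?_, l2, l3, l4, l1, ?_, ?_, ?_, ?_, ?_⟩
  · rw [Sym2.eq_swap (a := b)]
    tauto
  all_goals grind

theorem SegCycle.mem_V (h : H.SegCycle e f a c b d S₁ S₂ S₃ S₄) :
    a ∈ H.V ∧ b ∈ H.V ∧ c ∈ H.V ∧ d ∈ H.V := by
  obtain ⟨⟨he, hf⟩, h2, -⟩ := h
  have h1 := H.ends_mem e he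
  have h3 := H.ends_mem f hf
  rcases h2 with ⟨h4, h5⟩ | ⟨h4, h5⟩
  · exact ⟨h1 a (by simp [h4]), h1 b (by simp [h4]), h3 c (by simp [h5]), h3 d (by simp [h5])⟩
  · exact ⟨h3 a (by simp [h4]), h3 b (by simp [h4]), h1 c (by simp [h5]), h1 d (by simp [h5])⟩

theorem Loopless.exists_setLink_contractCycle (hH : H.Loopless) {C : Finset ℕ} {S : Set ℕ}
    {x y : ℕ} (h : SetLink H.Adj S x y)
    (hxy : H.cmapOn (H.vertsOf C) x ≠ H.cmapOn (H.vertsOf C) y) :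
    ∃ S', SetLink (H.contractCycle C).Adj S' (H.cmapOn (H.vertsOf C) x)
      (H.cmapOn (H.vertsOf C) y) ∧ ∀ v ∈ S', v ∈ H.cmapOn (H.vertsOf C) '' S ∧
        v ≠ H.cmapOn (H.vertsOf C) x ∧ v ≠ H.cmapOn (H.vertsOf C) y := by
  have hA := hH.connIn_contractCycle C (h.connIn fun _ _ h => h.symm)
  obtain ⟨z, l, -, hz, h3, h4⟩ := hA.exists_isLink (X := {H.cmapOn (H.vertsOf C) y})
    (Set.mem_image_of_mem _ (.inl (.inl rfl))) hxy
    (Set.mem_image_of_mem _ (.inl (.inr rfl))) rfl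
  obtain rfl : z = _ := hz
  refine ⟨_, h3.setLink fun _ _ h => h.symm, fun v hv => ?_⟩
  obtain ⟨⟨p, hp, rfl⟩, h5, h6⟩ := h4 v hv
  refine ⟨?_, h6, h5⟩
  rcases hp with (rfl | rfl) | hp
  · exact absurd rfl h6
  · exact absurd rfl h5
  · exact Set.mem_image_of_mem _ hp

theorem SegCycle.contractCycle (h : H.SegCycle e f a c b d S₁ S₂ S₃ S₄) (hH : H.Loopless)
    {C : Finset ℕ} (ha : a ∈ H.vertsOf C) (hb : b ∉ H.vertsOf C) (hc : c ∉ H.vertsOf C)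
    (hd : d ∉ H.vertsOf C) (h₂ : ∀ v ∈ S₂, v ∉ H.vertsOf C) (h₃ : ∀ v ∈ S₃, v ∉ H.vertsOf C) :
    ∃ a c b d S₁ S₂ S₃ S₄, (H.contractCycle C).SegCycle e f a c b d S₁ S₂ S₃ S₄ := by
  have hφ := fun v w => cmapOn_eq_iff (H := H) (vertsOf_subset C) (v := v) (w := w)
  obtain ⟨⟨he, hf⟩, hch, l1, l2, l3, l4, hcor, s1, s2, s3, s4⟩ := h
  obtain ⟨T₁, k1, t1⟩ := hH.exists_setLink_contractCycle (C := C) l1 (by rw [Ne, hφ]; grind)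
  obtain ⟨T₂, k2, t2⟩ := hH.exists_setLink_contractCycle (C := C) l2 (by rw [Ne, hφ]; grind)
  obtain ⟨T₃, k3, t3⟩ := hH.exists_setLink_contractCycle (C := C) l3 (by rw [Ne, hφ]; grind)
  obtain ⟨T₄, k4, t4⟩ := hH.exists_setLink_contractCycle (C := C) l4 (by rw [Ne, hφ]; grind)
  have hend : ∀ g x y, g ∈ H.E → x ≠ y → y ∉ H.vertsOf C → H.ends g = s(x, y) →
      g ∈ (H.contractCycle C).E ∧ (H.contractCycle C).ends g =
        s(H.cmapOn (H.vertsOf C) x, H.cmapOn (H.vertsOf C) y) := by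
    intro g x y hg hne hy hxy
    refine ⟨(hH.mem_contractCycle hxy).2 ⟨hg, by rw [Ne, hφ]; grind⟩, ?_⟩
    rw [contractCycle_ends, hxy]
    rfl
  have hV : ∀ p ∈ H.V, H.cmapOn (H.vertsOf C) p ∈ (H.contractCycle C).V :=
    fun p hp => Finset.mem_image_of_mem _ hp
  have u1 : ∀ v ∈ T₁, ∃ p ∈ S₁, p ∉ H.vertsOf C ∧ H.cmapOn (H.vertsOf C) p = v := by
    intro v hv
    obtain ⟨⟨p, hp, rfl⟩, hpa, -⟩ := t1 v hv
    exact ⟨p, hp, fun h => hpa ((hφ _ _).2 (.inr ⟨h, ha⟩)), rfl⟩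
  have u2 : ∀ v ∈ T₂, ∃ p ∈ S₂, p ∉ H.vertsOf C ∧ H.cmapOn (H.vertsOf C) p = v := by
    intro v hv
    obtain ⟨⟨p, hp, rfl⟩, -⟩ := t2 v hv
    exact ⟨p, hp, h₂ p hp, rfl⟩
  have u3 : ∀ v ∈ T₃, ∃ p ∈ S₃, p ∉ H.vertsOf C ∧ H.cmapOn (H.vertsOf C) p = v := by
    intro v hv
    obtain ⟨⟨p, hp, rfl⟩, -⟩ := t3 v hv
    exact ⟨p, hp, h₃ p hp, rfl⟩
  have u4 : ∀ v ∈ T₄, ∃ p ∈ S₄, p ∉ H.vertsOf C ∧ H.cmapOn (H.vertsOf C) p = v := by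
    intro v hv
    obtain ⟨⟨p, hp, rfl⟩, -, hpa⟩ := t4 v hv
    exact ⟨p, hp, fun h => hpa ((hφ _ _).2 (.inr ⟨h, ha⟩)), rfl⟩
  have hinj : ∀ p q, p ∉ H.vertsOf C →
      H.cmapOn (H.vertsOf C) p = H.cmapOn (H.vertsOf C) q → p = q := by
    intro p q hp h
    rw [hφ] at h
    tauto
  clear t1 t2 t3 t4
  refine ⟨_, _, _, _, T₁, T₂, T₃, T₄, ?_, ?_, k1, k2, k3, k4, ?_, ?_, ?_, ?_, ?_⟩
  · rcases hch with ⟨h1, h2⟩ | ⟨h1, h2⟩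
    · exact ⟨(hend e a b he hcor.1 hb h1).1, (hend f c d hf hcor.2.2.2.2.2 hd h2).1⟩
    · exact ⟨(hend e c d he hcor.2.2.2.2.2 hd h2).1, (hend f a b hf hcor.1 hb h1).1⟩
  · rcases hch with ⟨h1, h2⟩ | ⟨h1, h2⟩
    · exact .inl ⟨(hend e a b he hcor.1 hb h1).2, (hend f c d hf hcor.2.2.2.2.2 hd h2).2⟩
    · exact .inr ⟨(hend f a b hf hcor.1 hb h1).2, (hend e c d he hcor.2.2.2.2.2 hd h2).2⟩
  · simp only [Ne, hφ]
    grind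
  · clear k1 k2 k3 k4 l1 l2 l3 l4 hφ hend
    intro v hv
    obtain ⟨p, hp, hpU, rfl⟩ := u1 v hv
    have := hV p (s1 p hp).1
    grind
  · clear k1 k2 k3 k4 l1 l2 l3 l4 hφ hend
    intro v hv
    obtain ⟨p, hp, hpU, rfl⟩ := u2 v hv
    have := hV p (s2 p hp).1
    grind
  · clear k1 k2 k3 k4 l1 l2 l3 l4 hφ hend
    intro v hv
    obtain ⟨p, hp, hpU, rfl⟩ := u3 v hv
    have := hV p (s3 p hp).1
    grind
  · clear k1 k2 k3 k4 l1 l2 l3 l4 hφ hend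
    intro v hv
    obtain ⟨p, hp, hpU, rfl⟩ := u4 v hv
    have := hV p (s4 p hp).1
    grind

/-- A cycle through `x` and `y` avoiding a connected set with `x'` and `y'`, where `e = xx'`
and `f = yy'`, contracts to a hub. -/
theorem hasTerminal_of_cycle (hef : e ≠ f) (hH : H.Loopless) (hc : H.CutsGeThree)
    {C : Finset ℕ} {x x' y y' : ℕ} {Q : Set ℕ} (he : e ∈ H.E) (hf : f ∈ H.E)
    (hends : H.ends e = s(x, x')) (hends' : H.ends f = s(y, y')) (hC : H.IsCycleSet C)
    (hx : x ∈ H.vertsOf C) (hy : y ∈ H.vertsOf C) (hQ : ConnIn H.Adj Q) (hx' : x' ∈ Q)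
    (hy' : y' ∈ Q) (hQV : Q ⊆ H.V) (hQC : ∀ q ∈ Q, q ∉ H.vertsOf C) : H.HasTerminal e f := by
  refine .of_contractCycle hC (HasHub.hasTerminal hef ?_ (hH.contractCycle C)
    (hc.contractCycle hH C))
  refine hH.hasHub_contractCycle he hf hends hends' hQ hQV hx' hy' (.inr ⟨hx, hy⟩) ?_ ?_ <;>
    exact fun q hq => ⟨fun h => hQC q hq (by rwa [h]), fun h => hQC q hq h.2⟩

theorem exists_isCycleSet_of_adj {M N : Set ℕ} (hM : ConnIn H.Adj M) (hN : ConnIn H.Adj N)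
    (hMN : ∀ v ∈ M, v ∉ N) {x y p q : ℕ} (hx : x ∈ N) (hy : y ∈ N) (hxy : x ≠ y)
    (hp : p ∈ M) (hq : q ∈ M) (hxp : H.Adj x p) (hqy : H.Adj q y) :
    ∃ C, H.IsCycleSet C ∧ (∀ v ∈ H.vertsOf C, v ∈ M ∨ v ∈ N) ∧ x ∈ H.vertsOf C ∧
      y ∈ H.vertsOf C := by
  obtain ⟨g₁, hg₁, h₁⟩ := hxp
  obtain ⟨g₂, hg₂, h₂⟩ := hqy
  have hne : g₁ ≠ g₂ := by
    rintro rfl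
    rw [h₁, Sym2.eq_iff] at h₂
    grind
  obtain ⟨C, hC, h, -, -, k1, k2⟩ := exists_isCycleSet hM hN (Set.disjoint_left.2 hMN) hg₁ hg₂
    hne (by rw [h₁, Sym2.eq_swap]) h₂ hp hq hx hy
  exact ⟨C, hC, h, k1, k2⟩

theorem hasTerminal_of_hasDoubleLink (hef : e ≠ f) (hH : H.Loopless) (hc : H.CutsGeThree)
    {x x' y y' : ℕ} (he : e ∈ H.E) (hf : f ∈ H.E) (hends : H.ends e = s(x, x'))
    (hends' : H.ends f = s(y, y')) (hne : x ≠ y ∧ x ≠ y' ∧ x' ≠ y ∧ x' ≠ y')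
    (h : HasDoubleLink H.Adj H.V x x' y y') : H.HasTerminal e f := by
  have hsymm : ∀ u v, H.Adj u v → H.Adj v u := fun _ _ h => h.symm
  obtain ⟨m₁, m₂, m₃, h1, h2, h3, hm, d1, d2, d3⟩ := h
  have hxx := hH.ne_of_ends he hends
  have hyy := hH.ne_of_ends hf hends'
  have hx'V := H.ends_mem e he x' (by simp [hends])
  have hy'V := H.ends_mem f hf y' (by simp [hends'])
  have key : ∀ m m' : List ℕ, IsLink H.Adj x m y → IsLink H.Adj x m' y → m ≠ [] →
      (∀ v ∈ m, v ∉ m') → (∀ v ∈ m, v ≠ x ∧ v ≠ y) →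
      ∃ C, H.IsCycleSet C ∧ (∀ v ∈ H.vertsOf C, v ∈ m ∨ v = x ∨ v = y ∨ v ∈ m') ∧
        x ∈ H.vertsOf C ∧ y ∈ H.vertsOf C := by
    intro m m' hm hm' hne' hmm hmxy
    obtain ⟨z, l, rfl⟩ := List.exists_cons_of_ne_nil hne'
    obtain ⟨q, hq, hqy⟩ := hm.exists_adj_right hne'
    obtain ⟨C, hC, hCV, h⟩ := exists_isCycleSet_of_adj (hm.connIn hsymm)
      ((hm'.setLink hsymm).connIn hsymm) (by grind) (x := x) (y := y) (by simp) (by simp) hne.1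
      (p := z) (q := q) (by simp) hq hm.1 hqy
    exact ⟨C, hC, fun v hv => by have := hCV v hv; grind, h⟩
  obtain ⟨C, hC, hCV, hx, hy⟩ : ∃ C, H.IsCycleSet C ∧
      (∀ v ∈ H.vertsOf C, v ∈ m₁ ∨ v = x ∨ v = y ∨ v ∈ m₂) ∧
        x ∈ H.vertsOf C ∧ y ∈ H.vertsOf C := by
    rcases hm with hm | hm
    · exact key m₁ m₂ h1 h2 hm (by grind) (by grind)
    · obtain ⟨C, hC, hCV, h⟩ := key m₂ m₁ h2 h1 hm (by grind) (by grind)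
      exact ⟨C, hC, fun v hv => by have := hCV v hv; grind, h⟩
  refine hasTerminal_of_cycle hef hH hc he hf hends hends' hC hx hy
    ((h3.setLink hsymm).connIn hsymm) (by simp) (by simp) ?_ ?_
  · rintro v ((rfl | rfl) | hv)
    · exact hx'V
    · exact hy'V
    · exact (d3 v hv).1
  · rintro v ((rfl | rfl) | hv) hvC <;> have := hCV _ hvC <;> grind

end MGraph

namespace MGraph

variable {H : MGraph} {e f a c b d : ℕ} {S₁ S₂ S₃ S₄ : Set ℕ}

/-- No cycle meets a segment cycle only in a corner and its two incident segments. -/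
def NoCornerCycle (H : MGraph) (e f : ℕ) : Prop :=
  ∀ a c b d S₁ S₂ S₃ S₄, H.SegCycle e f a c b d S₁ S₂ S₃ S₄ → ∀ C, H.IsCycleSet C →
    a ∈ H.vertsOf C → b ∉ H.vertsOf C → c ∉ H.vertsOf C → d ∉ H.vertsOf C →
    (∀ v ∈ S₂, v ∉ H.vertsOf C) → (∀ v ∈ S₃, v ∉ H.vertsOf C) → False

/-- No cycle through two consecutive corners of a segment cycle avoids the opposite segment. -/
def NoSideCycle (H : MGraph) (e f : ℕ) : Prop :=
  ∀ a c b d S₁ S₂ S₃ S₄, H.SegCycle e f a c b d S₁ S₂ S₃ S₄ → ∀ C, H.IsCycleSet C →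
    a ∈ H.vertsOf C → c ∈ H.vertsOf C → b ∉ H.vertsOf C → d ∉ H.vertsOf C →
    (∀ v ∈ S₃, v ∉ H.vertsOf C) → False

theorem NoCornerCycle.not_two_edges (hP : H.NoCornerCycle e f)
    (h : H.SegCycle e f a c b d S₁ S₂ S₃ S₄) {M : Set ℕ} (hM : ConnIn H.Adj M)
    (hMS : ∀ v ∈ M, v ≠ a ∧ v ≠ b ∧ v ≠ c ∧ v ≠ d ∧ v ∉ S₂ ∧ v ∉ S₃) {g₁ g₂ m₁ m₂ : ℕ}
    (hg₁ : g₁ ∈ H.E) (hg₂ : g₂ ∈ H.E) (hg : g₁ ≠ g₂) (h₁ : H.ends g₁ = s(m₁, a))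
    (h₂ : H.ends g₂ = s(m₂, a)) (hm₁ : m₁ ∈ M) (hm₂ : m₂ ∈ M) : False := by
  obtain ⟨C, hC, hCV, -, -, ha, -⟩ := exists_isCycleSet hM (connIn_singleton H.Adj a)
    (by simpa using fun h => (hMS a h).1 rfl) hg₁ hg₂ hg h₁ h₂ hm₁ hm₂ rfl rfl
  have hCV' : ∀ v ∈ H.vertsOf C, v ∈ M ∨ v = a := hCV
  have hcor := h.corners
  have s2 := h.seg₂
  have s3 := h.seg₃
  exact hP _ _ _ _ _ _ _ _ h C hC ha (by grind) (by grind) (by grind) (by grind) (by grind)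

theorem NoSideCycle.not_adj (hW : H.NoSideCycle e f)
    (h : H.SegCycle e f a c b d S₁ S₂ S₃ S₄) {M N : Set ℕ} (hM : ConnIn H.Adj M)
    (hN : ConnIn H.Adj N) (hMN : ∀ v ∈ M, v ∉ N)
    (hMS : ∀ v, v ∈ M ∨ v ∈ N → v ≠ b ∧ v ≠ d ∧ v ∉ S₃) (ha : a ∈ N) (hc : c ∈ N)
    {p q : ℕ} (hp : p ∈ M) (hq : q ∈ M) (hap : H.Adj a p) (hqc : H.Adj q c) : False := by
  obtain ⟨C, hC, hCV, haC, hcC⟩ :=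
    exists_isCycleSet_of_adj hM hN hMN ha hc h.corners.2.1 hp hq hap hqc
  exact hW _ _ _ _ _ _ _ _ h C hC haC hcC (fun hb => (hMS b (hCV b hb)).1 rfl)
    (fun hd => (hMS d (hCV d hd)).2.1 rfl) fun v hv hvC => (hMS v (hCV v hvC)).2.2 hv

theorem NoSideCycle.not_attached (hW : H.NoSideCycle e f)
    (h : H.SegCycle e f a c b d S₁ S₂ S₃ S₄) {M : Set ℕ} (hM : ConnIn H.Adj M)
    (hMS : ∀ v ∈ M, v ≠ a ∧ v ≠ b ∧ v ≠ c ∧ v ≠ d ∧ v ∉ S₁ ∧ v ∉ S₃)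
    {p q : ℕ} (hp : p ∈ M) (hq : q ∈ M) (hpa : H.Adj p a) (hqc : H.Adj q c) : False := by
  have hcor := h.corners
  have s1 := h.seg₁
  have s3 := h.seg₃
  exact hW.not_adj h hM (h.link₁.connIn fun _ _ h => h.symm)
    (by rintro v hv ((rfl | rfl) | hv') <;> grind)
    (by rintro v (hv | ((rfl | rfl) | hv)) <;> grind) (by simp) (by simp) hp hq hpa.symm hqc

theorem SegCycle.subset_corners (hc : H.CutsGeThree)
    (hP : H.NoCornerCycle e f) (hW : H.NoSideCycle e f)
    (h : H.SegCycle e f a c b d S₁ S₂ S₃ S₄)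
    (hmax : ∀ v ∈ H.V, (v ≠ a ∧ v ≠ b ∧ v ≠ c ∧ v ≠ d ∧ v ∉ S₁ ∧ v ∉ S₂ ∧ v ∉ S₃ ∧ v ∉ S₄) →
      ∀ p, p ∈ S₁ ∨ p ∈ S₂ ∨ p ∈ S₃ ∨ p ∈ S₄ → ¬ H.Adj v p) :
    ∀ v ∈ H.V, v = a ∨ v = b ∨ v = c ∨ v = d ∨ v ∈ S₁ ∨ v ∈ S₂ ∨ v ∈ S₃ ∨ v ∈ S₄ := by
  by_contra! hcon
  obtain ⟨w, hwV, hw⟩ := hcon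
  obtain ⟨M, hwM, hMR, hM, hMmax⟩ := exists_component (r := H.Adj) (fun _ _ h => h.symm)
    (R := {v | v ∈ H.V ∧ v ≠ a ∧ v ≠ b ∧ v ≠ c ∧ v ≠ d ∧ v ∉ S₁ ∧ v ∉ S₂ ∧ v ∉ S₃ ∧ v ∉ S₄})
    (w := w) ⟨hwV, hw⟩
  have hMR' : ∀ v ∈ M, v ∈ H.V ∧
    v ≠ a ∧ v ≠ b ∧ v ≠ c ∧ v ≠ d ∧ v ∉ S₁ ∧ v ∉ S₂ ∧ v ∉ S₃ ∧ v ∉ S₄ := hMR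
  obtain ⟨g, x, y, hg, hgxy⟩ := hc M ⟨w, hwV, hwM⟩
    ⟨a, h.mem_V.1, fun h => (hMR' a h).2.1 rfl⟩
  have hy : ∀ i, y i = a ∨ y i = b ∨ y i = c ∨ y i = d := by
    intro i
    obtain ⟨h1, h2, h3, h4⟩ := hgxy i
    have h5 := H.ends_mem _ h1 (y i) (by simp [h2])
    have h6 : H.Adj (x i) (y i) := ⟨_, h1, h2⟩
    have h7 := hmax _ (hMR' _ h3).1 (hMR' _ h3).2 (y i)
    by_contra! hcon
    refine h4 (hMmax _ h3 _ ⟨h5, ?_⟩ h6)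
    tauto
  have hinj : ∀ i j, i ≠ j → y i ≠ y j := by
    intro i j hij hyij
    obtain ⟨i1, i2, i3, -⟩ := hgxy i
    obtain ⟨j1, j2, j3, -⟩ := hgxy j
    rw [← hyij] at j2
    have hgij : g i ≠ g j := fun h => hij (hg h)
    rcases hy i with h' | h' | h' | h' <;> rw [h'] at i2 j2
    · exact hP.not_two_edges h hM (by grind) i1 j1 hgij i2 j2 i3 j3
    · exact hP.not_two_edges h.rotate.rotate hM (by grind) i1 j1 hgij i2 j2 i3 j3
    · exact hP.not_two_edges h.rotate hM (by grind) i1 j1 hgij i2 j2 i3 j3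
    · exact hP.not_two_edges h.rotate.rotate.rotate hM (by grind) i1 j1 hgij i2 j2 i3 j3
  have k1 : ∀ i j, ¬ (y i = a ∧ y j = c) := fun i j hij =>
    hW.not_attached h hM (by grind) (hgxy i).2.2.1 (hgxy j).2.2.1
      ⟨_, (hgxy i).1, hij.1 ▸ (hgxy i).2.1⟩ ⟨_, (hgxy j).1, hij.2 ▸ (hgxy j).2.1⟩
  have k2 : ∀ i j, ¬ (y i = c ∧ y j = b) := fun i j hij =>
    hW.not_attached h.rotate hM (by grind) (hgxy i).2.2.1 (hgxy j).2.2.1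
      ⟨_, (hgxy i).1, hij.1 ▸ (hgxy i).2.1⟩ ⟨_, (hgxy j).1, hij.2 ▸ (hgxy j).2.1⟩
  have k3 : ∀ i j, ¬ (y i = b ∧ y j = d) := fun i j hij =>
    hW.not_attached h.rotate.rotate hM (by grind) (hgxy i).2.2.1 (hgxy j).2.2.1
      ⟨_, (hgxy i).1, hij.1 ▸ (hgxy i).2.1⟩ ⟨_, (hgxy j).1, hij.2 ▸ (hgxy j).2.1⟩
  have k4 : ∀ i j, ¬ (y i = d ∧ y j = a) := fun i j hij =>
    hW.not_attached h.rotate.rotate.rotate hM (by grind) (hgxy i).2.2.1 (hgxy j).2.2.1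
      ⟨_, (hgxy i).1, hij.1 ▸ (hgxy i).2.1⟩ ⟨_, (hgxy j).1, hij.2 ▸ (hgxy j).2.1⟩
  have h0 := hy 0
  have h1 := hy 1
  have h2 := hy 2
  have h01 := hinj 0 1 (by decide)
  have h02 := hinj 0 2 (by decide)
  have h12 := hinj 1 2 (by decide)
  grind

set_option maxHeartbeats 1600000 in
theorem SegCycle.seg_eq_empty (hc : H.CutsGeThree)
    (hP : H.NoCornerCycle e f) (hW : H.NoSideCycle e f)
    (h : H.SegCycle e f a c b d S₁ S₂ S₃ S₄)
    (hV : ∀ v ∈ H.V, v = a ∨ v = b ∨ v = c ∨ v = d ∨ v ∈ S₁ ∨ v ∈ S₂ ∨ v ∈ S₃ ∨ v ∈ S₄) :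
    S₁ = ∅ := by
  have hsymm : ∀ u v, H.Adj u v → H.Adj v u := fun _ _ h => h.symm
  have h' := h
  obtain ⟨-, -, l1, l2, l3, l4, hcor, s1, s2, s3, s4⟩ := h'
  rcases l1 with ⟨h0, -⟩ | ⟨hS, ⟨p, hp, hap⟩, q, hq, hqc⟩
  · exact h0
  exfalso
  obtain ⟨g, x, y, hg, hgxy⟩ := hc S₁ ⟨p, (s1 p hp).1, hp⟩ ⟨a, h.mem_V.1, by grind⟩
  have ka : ∀ i j, i ≠ j → ¬ (y i = a ∧ y j = a) := fun i j hij hy =>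
    hP.not_two_edges h hS (by grind) (hgxy i).1 (hgxy j).1 (fun h => hij (hg h))
      (hy.1 ▸ (hgxy i).2.1) (hy.2 ▸ (hgxy j).2.1) (hgxy i).2.2.1 (hgxy j).2.2.1
  have kc : ∀ i j, i ≠ j → ¬ (y i = c ∧ y j = c) := fun i j hij hy =>
    hP.not_two_edges h.rotate hS (by grind) (hgxy i).1 (hgxy j).1 (fun h => hij (hg h))
      (hy.1 ▸ (hgxy i).2.1) (hy.2 ▸ (hgxy j).2.1) (hgxy i).2.2.1 (hgxy j).2.2.1
  obtain ⟨i, hia, hic⟩ : ∃ i, y i ≠ a ∧ y i ≠ c := by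
    have h01 : (0 : Fin 3) ≠ 1 := by decide
    have h02 : (0 : Fin 3) ≠ 2 := by decide
    have h12 : (1 : Fin 3) ≠ 2 := by decide
    have a1 := ka 0 1 h01
    have a2 := ka 0 2 h02
    have a3 := ka 1 2 h12
    have c1 := kc 0 1 h01
    have c2 := kc 0 2 h02
    have c3 := kc 1 2 h12
    by_contra! hcon
    have := hcon 0
    have := hcon 1
    have := hcon 2
    tauto
  obtain ⟨h1, h2, h3, h4⟩ := hgxy i
  have hadj : H.Adj (x i) (y i) := ⟨_, h1, h2⟩
  have hyV := hV (y i) (H.ends_mem _ h1 _ (by simp [h2]))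
  generalize y i = z at *
  rcases hyV with hy | rfl | hy | rfl | hy | hy | hy | hy
  · exact hia hy
  · exact hW.not_adj h.rotate hS (l2.connIn hsymm)
      (by rintro v hv ((rfl | rfl) | hv') <;> grind)
      (by rintro v (hv | ((rfl | rfl) | hv)) <;> grind) (by simp) (by simp) hq h3 hqc.symm hadj
  · exact hic hy
  · exact hW.not_adj h.rotate.rotate.rotate hS (l4.connIn hsymm)
      (by rintro v hv ((rfl | rfl) | hv') <;> grind)
      (by rintro v (hv | ((rfl | rfl) | hv)) <;> grind) (by simp) (by simp) h3 hp hadj.symm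
      hap.symm
  · exact h4 hy
  · rcases l2 with ⟨rfl, -⟩ | ⟨hS', ⟨p', hp', hcp⟩, -⟩
    · exact hy
    obtain ⟨g₁, hg₁, k1⟩ := hqc
    obtain ⟨g₂, hg₂, k2⟩ := hcp.symm
    refine hP.not_two_edges h.rotate (hS.union hsymm hS' h3 hy hadj)
      (by rintro v (hv | hv) <;> grind) hg₁ hg₂ ?_ k1 k2 (.inl hq) (.inr hp')
    rintro rfl
    rw [k1, Sym2.eq_iff] at k2
    grind
  · rcases l3 with ⟨rfl, -⟩ | ⟨hS', ⟨p', hp', hbp⟩, -⟩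
    · exact hy
    refine hW.not_adj h.rotate (hS.union hsymm hS' h3 hy hadj) (l2.connIn hsymm)
      (by rintro v (hv | hv) ((rfl | rfl) | hv') <;> grind)
      (by rintro v ((hv | hv) | ((rfl | rfl) | hv)) <;> grind) (by simp) (by simp) (.inl hq)
      (.inr hp') hqc.symm hbp.symm
  · rcases l4 with ⟨rfl, -⟩ | ⟨hS', -, q', hq', hqa⟩
    · exact hy
    obtain ⟨g₁, hg₁, k1⟩ := hap.symm
    obtain ⟨g₂, hg₂, k2⟩ := hqa
    refine hP.not_two_edges h (hS.union hsymm hS' h3 hy hadj)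
      (by rintro v (hv | hv) <;> grind) hg₁ hg₂ ?_ k1 k2 (.inl hp) (.inr hq')
    rintro rfl
    rw [k1, Sym2.eq_iff] at k2
    grind

theorem NoSideCycle.unique_edge (hW : H.NoSideCycle e f)
    (h : H.SegCycle e f a c b d ∅ ∅ ∅ ∅) {g₁ g₂ : ℕ} (hg₁ : g₁ ∈ H.E) (hg₂ : g₂ ∈ H.E)
    (h₁ : H.ends g₁ = s(a, c)) (h₂ : H.ends g₂ = s(a, c)) : g₁ = g₂ := by
  by_contra hg
  have hcor := h.corners
  obtain ⟨C, hC, hCV, haC, -, hcC, -⟩ := exists_isCycleSet (connIn_singleton H.Adj a)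
    (connIn_singleton H.Adj c) (by simpa using hcor.2.1) hg₁ hg₂ hg h₁ h₂ rfl rfl rfl rfl
  have hCV' : ∀ v ∈ H.vertsOf C, v = a ∨ v = c := hCV
  exact hW _ _ _ _ _ _ _ _ h C hC haC hcC (by grind) (by grind) (by simp)

set_option maxHeartbeats 1600000 in
theorem SegCycle.isTerminal_of_empty (hH : H.Loopless) (hW : H.NoSideCycle e f)
    (h : H.SegCycle e f a c b d ∅ ∅ ∅ ∅) (hV : ∀ v ∈ H.V, v = a ∨ v = b ∨ v = c ∨ v = d)
    (hab : H.ends e = s(a, b)) (hcd : H.ends f = s(c, d)) : H.IsTerminal e f := by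
  have u1 := fun g₁ g₂ => hW.unique_edge h (g₁ := g₁) (g₂ := g₂)
  have u2 := fun g₁ g₂ => hW.unique_edge h.rotate (g₁ := g₁) (g₂ := g₂)
  have u3 := fun g₁ g₂ => hW.unique_edge h.rotate.rotate (g₁ := g₁) (g₂ := g₂)
  have u4 := fun g₁ g₂ => hW.unique_edge h.rotate.rotate.rotate (g₁ := g₁) (g₂ := g₂)
  have hmem := h.mem_V
  obtain ⟨⟨he, hf⟩, -, l1, l2, l3, l4, hcor, -⟩ := h
  have hlink : ∀ x y, SetLink H.Adj ∅ x y → H.Adj x y := by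
    rintro x y (⟨-, h⟩ | ⟨-, ⟨p, hp, -⟩, -⟩)
    · exact h
    · exact hp.elim
  obtain ⟨g₁, m1, k1⟩ := hlink _ _ l1
  obtain ⟨g₂, m2, k2⟩ := hlink _ _ l2
  obtain ⟨g₃, m3, k3⟩ := hlink _ _ l3
  obtain ⟨g₄, m4, k4⟩ := hlink _ _ l4
  have hVeq : H.V = {a, b, c, d} := by
    ext v
    have := hV v
    simp only [Finset.mem_insert, Finset.mem_singleton]
    grind
  have hends : ∀ g ∈ H.E, H.ends g = s(a, b) ∨ H.ends g = s(c, d) ∨ H.ends g = s(a, c) ∨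
      H.ends g = s(c, b) ∨ H.ends g = s(b, d) ∨ H.ends g = s(d, a) := by
    intro g hg
    obtain ⟨x, y, hxy⟩ := H.exists_ends g
    have h1 := hV x (H.ends_mem g hg x (by simp [hxy]))
    have h2 := hV y (H.ends_mem g hg y (by simp [hxy]))
    have h3 := hH.ne_of_ends hg hxy
    rw [hxy]
    simp only [Sym2.eq_iff]
    grind
  have hsub : ∀ g, g ∈ ({e, f, g₁, g₂, g₃, g₄} : Finset ℕ) → g ∈ H.E := by
    intro g hg
    simp only [Finset.mem_insert, Finset.mem_singleton] at hg
    grind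
  have hdist : H.ends e ≠ H.ends f ∧ H.ends e ≠ H.ends g₁ ∧ H.ends e ≠ H.ends g₂ ∧
      H.ends e ≠ H.ends g₃ ∧ H.ends e ≠ H.ends g₄ ∧ H.ends f ≠ H.ends g₁ ∧
      H.ends f ≠ H.ends g₂ ∧ H.ends f ≠ H.ends g₃ ∧ H.ends f ≠ H.ends g₄ ∧
      H.ends g₁ ≠ H.ends g₂ ∧ H.ends g₁ ≠ H.ends g₃ ∧ H.ends g₁ ≠ H.ends g₄ ∧
      H.ends g₂ ≠ H.ends g₃ ∧ H.ends g₂ ≠ H.ends g₄ ∧ H.ends g₃ ≠ H.ends g₄ := by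
    rw [hab, hcd, k1, k2, k3, k4]
    simp only [Ne, Sym2.eq_iff]
    grind
  refine .inr (.inr ⟨⟨H.V, {e, f, g₁, g₂, g₃, g₄}, H.ends, fun g hg => H.ends_mem g (hsub g hg)⟩,
    ⟨rfl, hsub, fun _ _ => rfl, fun g hg => hH g (hsub g hg), ?_, ?_⟩, by simp, by simp, ?_,
    ⟨?_, ?_, fun g hg => hH g (hsub g hg), ?_⟩, ?_⟩)
  · intro g hg g' hg' hgg
    simp only [Finset.mem_insert, Finset.mem_singleton] at hg hg'
    clear hends u1 u2 u3 u4 hsub hVeq hV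
    obtain ⟨d1, d2, d3, d4, d5, d6, d7, d8, d9, d10, d11, d12, d13, d14, d15⟩ := hdist
    rcases hg with rfl | rfl | rfl | rfl | rfl | rfl <;>
      rcases hg' with h | h | h | h | h | h <;> first
        | exact h.symm
        | (rw [h] at hgg; first | contradiction | (have := hgg.symm; contradiction))
  · intro g hg _
    simp only [Finset.mem_insert, Finset.mem_singleton, exists_eq_or_imp, exists_eq_left]
    rw [hab, hcd, k1, k2, k3, k4]
    rcases hends g hg with h | h | h | h | h | h <;> rw [h] <;> simp
  · rw [hab, hcd]
    simp only [Sym2.mem_iff]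
    grind
  · rw [hVeq]
    obtain ⟨q1, q2, q3, q4, q5, q6⟩ := hcor
    rw [Finset.card_insert_of_notMem (by simp [*]), Finset.card_insert_of_notMem (by simp [*]),
      Finset.card_pair q6]
  · have hn : ∀ x y : ℕ, H.ends x ≠ H.ends y → x ≠ y := fun x y h h' => h (h' ▸ rfl)
    obtain ⟨d1, d2, d3, d4, d5, d6, d7, d8, d9, d10, d11, d12, d13, d14, d15⟩ := hdist
    rw [Finset.card_insert_of_notMem (by simp [hn _ _ d1, hn _ _ d2, hn _ _ d3, hn _ _ d4,
        hn _ _ d5]),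
      Finset.card_insert_of_notMem (by simp [hn _ _ d6, hn _ _ d7, hn _ _ d8, hn _ _ d9]),
      Finset.card_insert_of_notMem (by simp [hn _ _ d10, hn _ _ d11, hn _ _ d12]),
      Finset.card_insert_of_notMem (by simp [hn _ _ d13, hn _ _ d14]),
      Finset.card_pair (hn _ _ d15)]
  · intro x hx y hy hxy
    have h1 := hV x hx
    have h2 := hV y hy
    simp only [Finset.mem_insert, Finset.mem_singleton, exists_eq_or_imp, exists_eq_left]
    rw [hab, hcd, k1, k2, k3, k4]
    simp only [Sym2.eq_iff]
    grind
  · intro g hg hge hgf g' hg' hne' hgg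
    rw [hab] at hge
    rw [hcd] at hgf
    rcases hends g hg with h | h | h | h | h | h
    · exact hge h
    · exact hgf h
    · exact hne' (u1 _ _ hg' hg (hgg.trans h) h)
    · exact hne' (u2 _ _ hg' hg (hgg.trans h) h)
    · exact hne' (u3 _ _ hg' hg (hgg.trans h) h)
    · exact hne' (u4 _ _ hg' hg (hgg.trans h) h)

set_option maxHeartbeats 800000 in
theorem SegCycle.exists_maximal (h : H.SegCycle e f a c b d S₁ S₂ S₃ S₄) :
    ∃ S₁ S₂ S₃ S₄, H.SegCycle e f a c b d S₁ S₂ S₃ S₄ ∧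
      ∀ v ∈ H.V, (v ≠ a ∧ v ≠ b ∧ v ≠ c ∧ v ≠ d ∧ v ∉ S₁ ∧ v ∉ S₂ ∧ v ∉ S₃ ∧ v ∉ S₄) →
        ∀ p, p ∈ S₁ ∨ p ∈ S₂ ∨ p ∈ S₃ ∨ p ∈ S₄ → ¬ H.Adj v p := by
  have hsymm : ∀ u v, H.Adj u v → H.Adj v u := fun _ _ h => h.symm
  induction hn : (H.V.filter fun v => v ∉ S₁ ∪ S₂ ∪ S₃ ∪ S₄).card using Nat.strong_induction_on
    generalizing S₁ S₂ S₃ S₄ with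
  | _ n ih =>
    subst hn
    by_cases hmax : ∀ v ∈ H.V, (v ≠ a ∧ v ≠ b ∧ v ≠ c ∧ v ≠ d ∧ v ∉ S₁ ∧ v ∉ S₂ ∧ v ∉ S₃ ∧
      v ∉ S₄) → ∀ p, p ∈ S₁ ∨ p ∈ S₂ ∨ p ∈ S₃ ∨ p ∈ S₄ → ¬ H.Adj v p
    · exact ⟨_, _, _, _, h, hmax⟩
    push Not at hmax
    obtain ⟨v, hvV, hv, p, hp, hvp⟩ := hmax
    have key : ∀ T₁ T₂ T₃ T₄ : Set ℕ, H.SegCycle e f a c b d T₁ T₂ T₃ T₄ →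
        T₁ ∪ T₂ ∪ T₃ ∪ T₄ = insert v (S₁ ∪ S₂ ∪ S₃ ∪ S₄) →
        ∃ S₁ S₂ S₃ S₄, H.SegCycle e f a c b d S₁ S₂ S₃ S₄ ∧
          ∀ v ∈ H.V, (v ≠ a ∧ v ≠ b ∧ v ≠ c ∧ v ≠ d ∧ v ∉ S₁ ∧ v ∉ S₂ ∧ v ∉ S₃ ∧ v ∉ S₄) →
            ∀ p, p ∈ S₁ ∨ p ∈ S₂ ∨ p ∈ S₃ ∨ p ∈ S₄ → ¬ H.Adj v p := by
      intro T₁ T₂ T₃ T₄ hT hTS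
      refine ih _ (Finset.card_lt_card ?_) hT rfl
      have hmem : ∀ w, w ∈ T₁ ∪ T₂ ∪ T₃ ∪ T₄ ↔ w = v ∨ w ∈ S₁ ∪ S₂ ∪ S₃ ∪ S₄ := fun w => by
        rw [hTS]; rfl
      rw [Finset.ssubset_iff_of_subset]
      · refine ⟨v, ?_, ?_⟩
        · rw [Finset.mem_filter]
          exact ⟨hvV, by simp only [Set.mem_union]; tauto⟩
        · rw [Finset.mem_filter, hmem]
          tauto
      · intro w hw
        rw [Finset.mem_filter, hmem] at hw
        rw [Finset.mem_filter]
        tauto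
    obtain ⟨h1, h2, l1, l2, l3, l4, h3, s1, s2, s3, s4⟩ := h
    rcases hp with hp | hp | hp | hp
    · refine key (insert v S₁) S₂ S₃ S₄ ⟨h1, h2, l1.insert hsymm hp hvp, l2, l3, l4, h3,
        ?_, ?_, ?_, ?_⟩ (by ext; simp only [Set.mem_union, Set.mem_insert_iff]; tauto) <;>
        intro w hw <;> have hi : w ∈ insert v S₁ ↔ w = v ∨ w ∈ S₁ := Iff.rfl <;>
        clear key ih <;> grind
    · refine key S₁ (insert v S₂) S₃ S₄ ⟨h1, h2, l1, l2.insert hsymm hp hvp, l3, l4, h3,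
        ?_, ?_, ?_, ?_⟩ (by ext; simp only [Set.mem_union, Set.mem_insert_iff]; tauto) <;>
        intro w hw <;> have hi : w ∈ insert v S₂ ↔ w = v ∨ w ∈ S₂ := Iff.rfl <;>
        clear key ih <;> grind
    · refine key S₁ S₂ (insert v S₃) S₄ ⟨h1, h2, l1, l2, l3.insert hsymm hp hvp, l4, h3,
        ?_, ?_, ?_, ?_⟩ (by ext; simp only [Set.mem_union, Set.mem_insert_iff]; tauto) <;>
        intro w hw <;> have hi : w ∈ insert v S₃ ↔ w = v ∨ w ∈ S₃ := Iff.rfl <;>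
        clear key ih <;> grind
    · refine key S₁ S₂ S₃ (insert v S₄) ⟨h1, h2, l1, l2, l3, l4.insert hsymm hp hvp, h3,
        ?_, ?_, ?_, ?_⟩ (by ext; simp only [Set.mem_union, Set.mem_insert_iff]; tauto) <;>
        intro w hw <;> have hi : w ∈ insert v S₄ ↔ w = v ∨ w ∈ S₄ := Iff.rfl <;>
        clear key ih <;> grind

theorem SegCycle.hasTerminal (hef : e ≠ f) (h : H.SegCycle e f a c b d S₁ S₂ S₃ S₄)
    (hH : H.Loopless) (hc : H.CutsGeThree) : H.HasTerminal e f := by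
  induction hn : H.V.card using Nat.strong_induction_on generalizing H a c b d S₁ S₂ S₃ S₄ with
  | _ n ih =>
    subst hn
    by_contra hno
    have hP : H.NoCornerCycle e f := by
      intro a c b d S₁ S₂ S₃ S₄ h C hC ha hb hc' hd h₂ h₃
      obtain ⟨_, _, _, _, _, _, _, _, h'⟩ := h.contractCycle hH ha hb hc' hd h₂ h₃
      exact hno (.of_contractCycle hC (ih _ (hH.card_contractCycle_lt hC) h' (hH.contractCycle C)
        (hc.contractCycle hH C) rfl))
    have hW : H.NoSideCycle e f := by
      intro a c b d S₁ S₂ S₃ S₄ h C hC ha hc' hb hd h₃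
      have hQ := h.link₃.connIn fun _ _ h => h.symm
      have hQV : {b, d} ∪ S₃ ⊆ (H.V : Set ℕ) := by
        rintro v ((rfl | rfl) | hv)
        · exact h.mem_V.2.1
        · exact h.mem_V.2.2.2
        · exact (h.seg₃ v hv).1
      have hQC : ∀ q ∈ {b, d} ∪ S₃, q ∉ H.vertsOf C := by
        rintro v ((rfl | rfl) | hv)
        exacts [hb, hd, h₃ v hv]
      rcases h.chords with ⟨h1, h2⟩ | ⟨h1, h2⟩
      · exact hno (hasTerminal_of_cycle hef hH hc h.memE.1 h.memE.2 h1 h2 hC ha hc' hQ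
          (by simp) (by simp) hQV hQC)
      · exact hno (hasTerminal_of_cycle hef hH hc h.memE.1 h.memE.2 h2 h1 hC hc' ha hQ
          (by simp) (by simp) hQV hQC)
    obtain ⟨S₁, S₂, S₃, S₄, h, hmax⟩ := h.exists_maximal
    have hV := h.subset_corners hc hP hW hmax
    obtain rfl := h.seg_eq_empty hc hP hW hV
    obtain rfl := h.rotate.seg_eq_empty hc hP hW (by grind)
    obtain rfl := h.rotate.rotate.seg_eq_empty hc hP hW (by grind)
    obtain rfl := h.rotate.rotate.rotate.seg_eq_empty hc hP hW (by grind)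
    simp only [Set.mem_empty_iff_false, or_false] at hV
    refine hno ⟨H, .refl, h.memE.1, h.memE.2, ?_⟩
    rcases h.chords with ⟨h1, h2⟩ | ⟨h1, h2⟩
    · exact h.isTerminal_of_empty hH hW hV h1 h2
    · exact h.rotate.isTerminal_of_empty hH hW (by grind) h2 (by rw [h1, Sym2.eq_swap])

end MGraph

namespace MGraph

variable {H : MGraph}

theorem IsWalk.exists_crossing {X : Set ℕ} {vs es : List ℕ} {u v : ℕ} (h : H.IsWalk vs es)
    (hu : vs.head? = some u) (hv : vs.getLast? = some v) (huX : u ∈ X) (hvX : v ∉ X) :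
    ∃ g ∈ es, ∃ x y, H.ends g = s(x, y) ∧ x ∈ X ∧ y ∉ X := by
  induction h generalizing u with
  | nil _ =>
    simp only [List.head?_cons, Option.some.injEq, List.getLast?_singleton] at hu hv
    subst hu hv
    exact absurd huX hvX
  | @cons u' w g vs es hg hends hw ih =>
    simp only [List.head?_cons, Option.some.injEq] at hu
    subst hu
    by_cases hwX : w ∈ X
    · obtain ⟨g', h1, h2⟩ := ih rfl (by simpa using hv) hwX
      exact ⟨g', List.mem_cons_of_mem _ h1, h2⟩
    · exact ⟨g, by simp, _, _, hends, huX, hwX⟩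

theorem IsWalk.isLink {vs es : List ℕ} {u v : ℕ} {l : List ℕ} (h : H.IsWalk vs es)
    (hvs : vs = u :: (l ++ [v])) : IsLink H.Adj u l v := by
  induction l generalizing u vs es with
  | nil =>
    subst hvs
    cases h with
    | cons he hends hw => exact ⟨_, he, hends⟩
  | cons z l ih =>
    subst hvs
    cases h with
    | cons he hends hw => exact ⟨⟨_, he, hends⟩, ih hw rfl⟩

theorem IsWalk.exists_edge {u v : ℕ} {es : List ℕ} (h : H.IsWalk [u, v] es) :
    ∃ g ∈ es, g ∈ H.E ∧ H.ends g = s(u, v) := by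
  cases h with
  | cons he hends hw => exact ⟨_, by simp, he, hends⟩

theorem IsPathBetween.exists_eq_append {vs es : List ℕ} {u v : ℕ}
    (h : H.IsPathBetween u v vs es) (huv : u ≠ v) : ∃ l, vs = u :: (l ++ [v]) := by
  obtain ⟨-, -, hu, hv⟩ := h
  cases vs with
  | nil => simp at hu
  | cons w t =>
    simp only [List.head?_cons, Option.some.injEq] at hu
    subst hu
    rcases List.eq_nil_or_concat t with rfl | ⟨l, z, rfl⟩
    · simp at hv
      exact absurd hv huv
    · refine ⟨l, ?_⟩
      have : (w :: (l ++ [z])).getLast? = some z := by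
        rw [← List.cons_append, List.getLast?_append]; simp
      simp only [List.concat_eq_append] at hv
      rw [this] at hv
      simp_all

theorem KConnected.connIn_diff (h : H.KConnected 3) (p q : ℕ) :
    ConnIn H.Adj ((H.V : Set ℕ) \ {p, q}) := by
  rintro x ⟨hxV, hx⟩ y ⟨hyV, hy⟩
  simp only [Set.mem_insert_iff, Set.mem_singleton_iff, not_or] at hx hy
  by_cases hxy : x = y
  · subst hxy; exact .refl
  obtain ⟨P, hP, hPd⟩ := h.2 x hxV y hyV hxy
  obtain ⟨i, hpi, hqi⟩ : ∃ i, p ∉ (P i).1 ∧ q ∉ (P i).1 := by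
    have hd : ∀ z, (x ≠ z ∧ y ≠ z) → ∀ i j, i ≠ j → ¬ (z ∈ (P i).1 ∧ z ∈ (P j).1) := by
      intro z hz i j hij hzij
      rcases (hPd i j hij).1 z hzij.1 hzij.2 with h | h
      exacts [hz.1 h.symm, hz.2 h.symm]
    have hp := hd p ⟨hx.1, hy.1⟩
    have hq := hd q ⟨hx.2, hy.2⟩
    have p1 := hp 0 1 (by decide)
    have p2 := hp 0 2 (by decide)
    have p3 := hp 1 2 (by decide)
    have q1 := hq 0 1 (by decide)
    have q2 := hq 0 2 (by decide)
    have q3 := hq 1 2 (by decide)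
    by_contra! hcon
    have := hcon 0
    have := hcon 1
    have := hcon 2
    tauto
  obtain ⟨hw, -, hu, hv⟩ := hP i
  refine Relation.ReflTransGen.mono ?_ _ _
    (hw.connIn x (List.mem_of_head? hu) y (List.mem_of_getLast? hv))
  rintro z w ⟨hzw, hmem⟩
  refine ⟨hzw, hw.subset_V w hmem, ?_⟩
  rintro (rfl | rfl)
  exacts [hpi hmem, hqi hmem]

theorem KConnected.cutsGeThree (h : H.KConnected 3) : H.CutsGeThree := by
  rintro X ⟨v, hvV, hv⟩ ⟨w, hwV, hw⟩
  obtain ⟨P, hP, hPd⟩ := h.2 v hvV w hwV fun h => hw (h ▸ hv)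
  have hcross := fun i => (hP i).1.exists_crossing (hP i).2.2.1 (hP i).2.2.2 hv hw
  choose g hg x y hgxy hx hy using hcross
  refine ⟨g, x, y, fun i j hij => ?_, fun i => ⟨(hP i).1.subset_E _ (hg i), hgxy i, hx i, hy i⟩⟩
  by_contra hne
  exact (hPd i j hne).2 _ (hg i) (hij ▸ hg j)

theorem KConnected.exists_links (hG : H.Simple) (h : H.KConnected 3) {a c : ℕ} (ha : a ∈ H.V)
    (hc : c ∈ H.V) (hac : a ≠ c) : ∃ I : Fin 3 → List ℕ, (∀ i, IsLink H.Adj a (I i) c) ∧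
      (∀ i, (I i).Nodup) ∧ (∀ i, ∀ v ∈ I i, v ∈ (H.V : Set ℕ) ∧ v ≠ a ∧ v ≠ c) ∧
      (∀ i j, i ≠ j → ∀ v ∈ I i, v ∉ I j) ∧ ∀ i j, i ≠ j → I i ≠ [] ∨ I j ≠ [] := by
  obtain ⟨P, hP, hPd⟩ := h.2 a ha c hc hac
  choose I hI using fun i => (hP i).exists_eq_append hac
  have hmem : ∀ i, ∀ v ∈ I i, v ∈ (P i).1 := fun i v hv => by rw [hI]; simp [hv]
  have hne : ∀ i, ∀ v ∈ I i, v ≠ a ∧ v ≠ c := by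
    intro i v hv
    have := (hP i).2.1
    rw [hI] at this
    simp only [List.nodup_cons, List.nodup_append, List.mem_append] at this
    grind
  refine ⟨I, fun i => (hP i).1.isLink (hI i), fun i => ?_,
    fun i v hv => ⟨(hP i).1.subset_V v (hmem i v hv), hne i v hv⟩, fun i j hij v hi hj => ?_,
    fun i j hij => ?_⟩
  · have := (hP i).2.1
    rw [hI, List.nodup_cons, List.nodup_append] at this
    exact this.2.1
  · rcases (hPd i j hij).1 v (hmem i v hi) (hmem j v hj) with h | h
    exacts [(hne i v hi).1 h, (hne i v hi).2 h]
  · by_contra! hcon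
    have hi := (hP i).1
    have hj := (hP j).1
    rw [hI, hcon.1] at hi
    rw [hI, hcon.2] at hj
    obtain ⟨g, hg, hgE, hgac⟩ := hi.exists_edge
    obtain ⟨g', hg', hgE', hgac'⟩ := hj.exists_edge
    obtain rfl := hG.2 g hgE g' hgE' (hgac.trans hgac'.symm)
    exact (hPd i j hij).2 g hg hg'

theorem hasTerminal_of_adjacent {e f u b d : ℕ} (hef : e ≠ f) (hG : H.Simple)
    (h3 : H.KConnected 3) (he : e ∈ H.E) (hf : f ∈ H.E) (heub : H.ends e = s(u, b))
    (hfud : H.ends f = s(u, d)) : H.HasTerminal e f := by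
  have hub := hG.1.ne_of_ends he heub
  have hud := hG.1.ne_of_ends hf hfud
  refine HasHub.hasTerminal hef ⟨he, hf, u, b, d, _, heub, hfud, h3.connIn_diff u u,
    Set.sdiff_subset, by simp, ⟨H.ends_mem e he b (by simp [heub]), ?_⟩,
    H.ends_mem f hf d (by simp [hfud]), ?_⟩ hG.1 h3.cutsGeThree
  · simpa using hub.symm
  · simpa using hud.symm

theorem KConnected.hasTerminal {e f : ℕ} (h3 : H.KConnected 3) (hG : H.Simple)
    (he : e ∈ H.E) (hf : f ∈ H.E) (hef : e ≠ f) : H.HasTerminal e f := by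
  obtain ⟨a, b, hab⟩ := H.exists_ends e
  obtain ⟨c, d, hcd⟩ := H.exists_ends f
  have hba := hab.trans Sym2.eq_swap
  have hdc := hcd.trans Sym2.eq_swap
  by_cases hac : a = c
  · exact hasTerminal_of_adjacent hef hG h3 he hf hab (hac ▸ hcd)
  by_cases had : a = d
  · exact hasTerminal_of_adjacent hef hG h3 he hf hab (had ▸ hdc)
  by_cases hbc : b = c
  · exact hasTerminal_of_adjacent hef hG h3 he hf hba (hbc ▸ hcd)
  by_cases hbd : b = d
  · exact hasTerminal_of_adjacent hef hG h3 he hf hba (hbd ▸ hdc)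
  have ne_ab := hG.1.ne_of_ends he hab
  have ne_cd := hG.1.ne_of_ends hf hcd
  have haV := H.ends_mem e he a (by simp [hab])
  have hbV := H.ends_mem e he b (by simp [hab])
  have hcV := H.ends_mem f hf c (by simp [hcd])
  have hdV := H.ends_mem f hf d (by simp [hcd])
  have hsymm : ∀ u v, H.Adj u v → H.Adj v u := fun _ _ h => h.symm
  have hc := h3.cutsGeThree
  obtain ⟨I, hI, hIn, hI', hdisj, hne⟩ := h3.exists_links hG haV hcV hac
  rcases hasLinkCycle_or_hasSomeDoubleLink hsymm h3.connIn_diff haV hbV hcV hdV ne_ab hac had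
    hbc hbd ne_cd I hI hIn hI' hdisj hne with
    ⟨l₁, l₂, l₃, l₄, h1, h2, h3, h4, s1, s2, s3, s4⟩ | h | h | h | h
  · exact SegCycle.hasTerminal hef ⟨⟨he, hf⟩, .inl ⟨hab, hcd⟩, h1.setLink hsymm, h2.setLink hsymm,
      h3.setLink hsymm, h4.setLink hsymm, ⟨ne_ab, hac, had, hbc, hbd, ne_cd⟩, s1, s2, s3, s4⟩
      hG.1 hc
  · exact hasTerminal_of_hasDoubleLink hef hG.1 hc he hf hab hcd ⟨hac, had, hbc, hbd⟩ h
  · exact hasTerminal_of_hasDoubleLink hef hG.1 hc he hf hba hcd ⟨hbc, hbd, hac, had⟩ h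
  · exact hasTerminal_of_hasDoubleLink hef hG.1 hc he hf hab hdc ⟨had, hac, hbd, hbc⟩ h
  · exact hasTerminal_of_hasDoubleLink hef hG.1 hc he hf hba hdc ⟨hbd, hbc, had, hac⟩ h

end MGraph

/-- Every simple 3-connected graph `G` with distinct edges `e`, `f` has a cc-minor `H`
containing `e` and `f` that is (i) a bond graph `B n` with `n ≥ 3`; or (ii) a fan-type
graph with `e` and `f` as distinct non-parallel outer spokes; or (iii) a graph whose
simplification has `e` and `f` as non-adjacent edges and is a `K₄`, where every edge of
`H` not parallel to `e` or `f` is not parallel to any edge of `H`. -/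
theorem statement_14 (G : MGraph) (e f : ℕ) (hG : G.Simple) (h3 : G.KConnected 3)
    (he : e ∈ G.E) (hf : f ∈ G.E) (hef : e ≠ f) :
    ∃ H, G.CCMinor H ∧ e ∈ H.E ∧ f ∈ H.E ∧
      ((∃ n, 3 ≤ n ∧ H.IsBondGraph n) ∨
       (∃ u vs pE S, IsFanType H u vs pE S ∧
          e ∈ S vs.head! ∧ f ∈ S vs.getLast! ∧ e ≠ f ∧ H.ends e ≠ H.ends f) ∨
       (∃ H', IsSimplification H H' ∧ e ∈ H'.E ∧ f ∈ H'.E ∧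
          (∀ x, x ∈ H.ends e → x ∉ H.ends f) ∧ IsK4 H' ∧
          (∀ g ∈ H.E, H.ends g ≠ H.ends e → H.ends g ≠ H.ends f →
            ∀ h ∈ H.E, h ≠ g → H.ends h ≠ H.ends g))) := by
  exact h3.hasTerminal hG he hf hef
end
end

section
/- For every integer t > 1 there is an integer f(t) (for example, f(t) = Σ_{i=1}^{⌊t/2⌋+1} t^i works) such that every weighted tree T with total weight w(V(T)) > f(t) contains one of the following: (i) a vertex v with degree d(v) > t; (ii) a path P with |V(P)| > t vertices; or (iii) a path P with w(V(P)) > t. -/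
namespace SimpleGraph

variable {V : Type*} {G : SimpleGraph V}

/-- In a connected graph, the vertices on a shortest walk from `a` are closer to `a` than to any
vertex `b` from which the endpoint is one step further away. -/
theorem Connected.dist_lt_dist_of_mem_support (hG : G.Connected) {a b x y : V} (p : G.Walk a x)
    (hp : p.length = G.dist a x) (hab : G.dist a x < G.dist b x) (hy : y ∈ p.support) :
    G.dist a y < G.dist b y := by
  classical
  have hlen := congrArg Walk.length (p.take_spec hy)
  rw [Walk.length_append] at hlen
  have h₁ := dist_le (p.takeUntil y hy)
  have h₂ := dist_le (p.dropUntil y hy)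
  have h₃ := hG.dist_triangle (u := b) (v := y) (w := x)
  omega

/-- A shortest walk to `b` and a shortest walk to `a`, joined by the edge `a b`, form a path when
the other endpoints lie on the respective sides of that edge. -/
theorem Connected.exists_isPath_of_adj_of_dist_lt (hG : G.Connected) {a b x y : V}
    (hab : G.Adj a b) (hx : G.dist a x < G.dist b x) (hy : G.dist b y < G.dist a y) :
    ∃ p : G.Walk x y, p.IsPath ∧ p.length = G.dist a x + 1 + G.dist b y := by
  obtain ⟨p, hp, hpl⟩ := hG.exists_path_of_dist a x
  obtain ⟨q, hq, hql⟩ := hG.exists_path_of_dist b y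
  refine ⟨p.reverse.append (Walk.cons hab q), ?_, ?_⟩
  · rw [Walk.isPath_def, Walk.support_append, Walk.support_cons, List.tail_cons,
      List.nodup_append']
    refine ⟨hp.reverse.support_nodup, hq.support_nodup, fun z hz hz' => ?_⟩
    rw [Walk.support_reverse, List.mem_reverse] at hz
    exact lt_asymm (hG.dist_lt_dist_of_mem_support p hpl hx hz)
      (hG.dist_lt_dist_of_mem_support q hql hy hz')
  · simp only [Walk.length_append, Walk.length_reverse, Walk.length_cons]
    omega

theorem Connected.exists_adj_dist_add_one (hG : G.Connected) {a x : V} (h : a ≠ x) :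
    ∃ b, G.Adj a b ∧ G.dist b x + 1 = G.dist a x := by
  obtain ⟨p, hp⟩ := hG.exists_walk_length_eq_dist a x
  cases p with
  | nil => exact absurd rfl h
  | @cons _ b _ hab q =>
    refine ⟨b, hab, ?_⟩
    have h₁ := dist_le q
    have h₂ := hG.dist_triangle (u := a) (v := b) (w := x)
    rw [Walk.length_cons] at hp
    rw [dist_eq_one_iff_adj.2 hab] at h₂
    omega

/-- A finite tree in which every path has at most `t` vertices has radius at most `t / 2`. -/
theorem IsTree.exists_forall_dist_le [Finite V] (hG : G.IsTree) {t : ℕ}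
    (ht : ∀ (u v : V) (p : G.Walk u v), p.IsPath → p.support.length ≤ t) :
    ∃ c, ∀ v, G.dist c v ≤ t / 2 := by
  have := Fintype.ofFinite V
  have hc := hG.connected
  have := hc.nonempty
  choose far hfar using fun c => Finite.exists_max (G.dist c)
  obtain ⟨c, hmin⟩ := Finite.exists_min fun c => G.dist c (far c)
  refine ⟨c, fun v => (hfar c v).trans ?_⟩
  by_contra! hlt
  have hne : c ≠ far c := by
    intro h
    rw [← h, dist_self] at hlt
    omega
  obtain ⟨b, hcb, hb⟩ := hc.exists_adj_dist_add_one hne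
  have h₁ := hmin b
  have h₂ := hfar c (far b)
  have h₃ := hG.dist_ne_of_adj (far b) hcb
  have h₄ := hc.dist_triangle (u := b) (v := c) (w := far b)
  rw [dist_eq_one_iff_adj.2 hcb.symm] at h₄
  rw [dist_comm, dist_comm (u := far b)] at h₃
  obtain ⟨p, hp, hpl⟩ := hc.exists_isPath_of_adj_of_dist_lt hcb.symm (x := far c) (y := far b)
    (by omega) (by omega)
  have h₅ := ht _ _ p hp
  rw [Walk.length_support] at h₅
  omega

theorem Connected.card_dist_eq_le_pow [Fintype V] [DecidableRel G.Adj] (hG : G.Connected)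
    {t : ℕ} (ht : ∀ v, G.degree v ≤ t) (c : V) (i : ℕ) :
    Finset.card {v | G.dist c v = i} ≤ t ^ i := by
  classical
  induction i with
  | zero => simp [hG.dist_eq_zero_iff, Finset.filter_eq]
  | succ i ih =>
    have hsub : ({v | G.dist c v = i + 1} : Finset V) ⊆
        ({v | G.dist c v = i} : Finset V).biUnion fun v => G.neighborFinset v := by
      intro v hv
      rw [Finset.mem_filter_univ] at hv
      have hne : v ≠ c := by
        rintro rfl
        simp at hv
      obtain ⟨b, hvb, hb⟩ := hG.exists_adj_dist_add_one hne
      rw [dist_comm, dist_comm (u := v)] at hb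
      simp only [Finset.mem_biUnion, Finset.mem_filter_univ, mem_neighborFinset]
      exact ⟨b, by omega, hvb.symm⟩
    calc _ ≤ _ := Finset.card_le_card hsub
      _ ≤ Finset.card {v | G.dist c v = i} * t := Finset.card_biUnion_le_card_mul _ _ _ fun v _ => ht v
      _ ≤ t ^ (i + 1) := by rw [pow_succ]; gcongr

theorem Connected.card_le_sum_pow [Fintype V] [DecidableRel G.Adj] (hG : G.Connected)
    {t r : ℕ} (ht : ∀ v, G.degree v ≤ t) {c : V} (hr : ∀ v, G.dist c v ≤ r) :
    Fintype.card V ≤ ∑ i ∈ Finset.range (r + 1), t ^ i := by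
  rw [← Finset.card_univ, Finset.card_eq_sum_card_fiberwise (f := G.dist c)
    (t := Finset.range (r + 1)) fun v _ => by simpa [Nat.lt_succ_iff] using hr v]
  exact Finset.sum_le_sum fun i _ => hG.card_dist_eq_le_pow ht c i

end SimpleGraph


/-- For every integer `t > 1`, the bound `f t = ∑_{i=1}^{⌊t/2⌋+1} t^i` is such that every
weighted tree of total weight exceeding `f t` has a vertex of degree exceeding `t`, or a
path with more than `t` vertices, or a path of total weight exceeding `t`. -/
theorem statement_15 (t : ℕ) (ht : 1 < t)
    (V : Type) [Fintype V] (T : SimpleGraph V) [DecidableRel T.Adj]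
    (hT : T.IsTree) (w : V → ℕ)
    (hw : (∑ i ∈ Finset.Icc 1 (t / 2 + 1), t ^ i) < ∑ v, w v) :
    (∃ v, t < T.degree v) ∨
    (∃ (u v : V) (P : T.Walk u v), P.IsPath ∧ t < P.support.length) ∨
    (∃ (u v : V) (P : T.Walk u v), P.IsPath ∧ t < (P.support.map w).sum) := by
  by_contra! h
  obtain ⟨hdeg, hlen, hweight⟩ := h
  obtain ⟨c, hc⟩ := hT.exists_forall_dist_le hlen
  have hcard := hT.connected.card_le_sum_pow hdeg hc
  have hwt : ∀ v, w v ≤ t := fun v => by simpa using hweight v v .nil .nil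
  refine hw.not_ge ?_
  calc ∑ v, w v ≤ Fintype.card V * t := by
        simpa using Finset.sum_le_card_nsmul Finset.univ w t fun v _ => hwt v
    _ ≤ (∑ i ∈ Finset.range (t / 2 + 1), t ^ i) * t := by gcongr
    _ = ∑ i ∈ Finset.Icc 1 (t / 2 + 1), t ^ i := by
        rw [Finset.range_eq_Ico, ← Finset.Ico_add_one_right_eq_Icc, Finset.sum_mul,
          ← Finset.sum_Ico_add' _ 0 _ 1]
        simp only [pow_succ]
end
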